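/- Let 0 < ε < 1/4 and let f encode a smooth embedded paper Moebius band of aspect ratio λ with λ < √3 + ε, with image Ω = f '' (ℝ × [0,1]). Then there exist points A, B, C ∈ ℝ³ with pairwise distances 2√3/3 such that every point of Ω is within distance 6√ε of the equilateral triangle convexHull ℝ {A, B, C}. -/

import Mathlib

section PaperBands

open Set Filter Topology
open scoped ContDiff RealInnerProductSpace

local notation "E3" => EuclideanSpace ℝ (Fin 3)

/-! ### A rigidity statement for a degenerate Hessian along a line -/

theorem eqOn_zero_of_hasDerivAt_mul {φ β : ℝ → ℝ} {a b c K : ℝ} (hc : c ∈ Ioo a b)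
    (hβ : ∀ t ∈ Ioo a b, HasDerivAt β (φ t * β t) t) (hK : ∀ t ∈ Ioo a b, |φ t| ≤ K)
    (h0 : β c = 0) : ∀ t ∈ Ioo a b, β t = 0 := by
  have hlip : ∀ t ∈ Ioo a b, LipschitzOnWith K.toNNReal (fun y => φ t * y) univ := by
    intro t ht
    refine LipschitzOnWith.of_dist_le_mul fun x _ y _ => ?_
    rw [Real.dist_eq, Real.dist_eq, ← mul_sub, abs_mul]
    have : |φ t| ≤ (K.toNNReal : ℝ) := (hK t ht).trans (Real.le_coe_toNNReal K)
    gcongr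
  have := ODE_solution_unique_of_mem_Ioo (v := fun t y => φ t * y) (s := fun _ => univ)
    (f := β) (g := fun _ => 0) hlip hc (fun t ht => ⟨hβ t ht, mem_univ _⟩)
    (fun t _ => ⟨by simpa using hasDerivAt_const t (0 : ℝ), mem_univ _⟩) h0
  exact this

theorem eq_of_hasDerivAt_zero {g : ℝ → ℝ} {a b c : ℝ} (hc : c ∈ Ioo a b)
    (hg : ∀ t ∈ Ioo a b, HasDerivAt g 0 t) : ∀ t ∈ Ioo a b, g t = g c := by
  intro t ht
  exact isOpen_Ioo.is_const_of_deriv_eq_zero isPreconnected_Ioo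
    (fun x hx => (hg x hx).differentiableAt.differentiableWithinAt)
    (fun x hx => (hg x hx).deriv) ht hc

/-- Here `α, β, γ` are the second derivatives of a function with vanishing Hessian determinant
along a line in the direction of differentiation of `γ`. -/
theorem degenerate_hessian_line {α β γ b g k p r m : ℝ → ℝ} {t₀ t₁ : ℝ} (h0 : (0 : ℝ) ∈ Ioo t₀ t₁)
    (hα : ∀ t, HasDerivAt α (b t) t) (hβ : ∀ t, HasDerivAt β (g t) t)
    (hb : ∀ t, HasDerivAt b (k t) t) (hp : Continuous p)
    (h1 : ∀ t ∈ Ioo t₀ t₁, α t * γ t = β t ^ 2)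
    (h2 : ∀ t ∈ Ioo t₀ t₁, p t * γ t + α t * g t = 2 * β t * b t)
    (h3 : ∀ t ∈ Ioo t₀ t₁, r t * γ t + 2 * p t * g t + α t * k t = 2 * b t ^ 2 + 2 * β t * m t)
    (hα0 : α 0 ≠ 0) (hβ0 : β 0 = 0) :
    ∀ t ∈ Ioo t₀ t₁, α t ≠ 0 ∧ β t = 0 ∧ γ t = 0 := by
  have cα : Continuous α := continuous_iff_continuousAt.2 fun t => (hα t).continuousAt
  have cβ : Continuous β := continuous_iff_continuousAt.2 fun t => (hβ t).continuousAt
  have cb : Continuous b := continuous_iff_continuousAt.2 fun t => (hb t).continuousAt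
  set κ := b 0 / α 0 ^ 2 with hκ
  set Z : Set ℝ := {t | β t = 0 ∧ b t = κ * α t ^ 2 ∧ α t * (1 / α 0 - κ * t) = 1} with hZ
  have hZc : IsClosed Z := by
    refine (isClosed_eq cβ continuous_const).inter ((isClosed_eq cb ?_).inter (isClosed_eq ?_ ?_))
    all_goals fun_prop
  have hZ0 : (0 : ℝ) ∈ Z := by
    refine ⟨hβ0, ?_, ?_⟩
    · rw [hκ]; field_simp
    · field_simp; ring
  have hopen : ∀ c ∈ Ioo t₀ t₁ ∩ Z, Z ∈ 𝓝 c := by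
    rintro c ⟨hc, hcβ, hcb, hcα⟩
    have hαc : α c ≠ 0 := by
      intro h; rw [h] at hcα; simp at hcα
    set φ : ℝ → ℝ := fun t => 2 * b t / α t - p t * β t / α t ^ 2 with hφ
    have hφc : ContinuousAt φ c := by
      have h2 : α c ^ 2 ≠ 0 := pow_ne_zero 2 hαc
      have e1 : ContinuousAt (fun t => 2 * b t) c := by fun_prop
      have e2 : ContinuousAt (fun t => p t * β t) c := by fun_prop
      have e3 : ContinuousAt (fun t => α t ^ 2) c := by fun_prop
      exact (e1.div cα.continuousAt hαc).sub (e2.div e3 h2)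
    have hev : ∀ᶠ t in 𝓝 c, t ∈ Ioo t₀ t₁ ∧ α t ≠ 0 ∧ |φ t| < |φ c| + 1 :=
      (show ∀ᶠ t in 𝓝 c, t ∈ Ioo t₀ t₁ from isOpen_Ioo.mem_nhds hc).and
        ((cα.continuousAt.eventually_ne hαc).and
          (hφc.abs.eventually_lt continuousAt_const (by linarith)))
    obtain ⟨δ, hδ, hδs⟩ := Metric.eventually_nhds_iff_ball.1 hev
    rw [Real.ball_eq_Ioo] at hδs
    have hcc : c ∈ Ioo (c - δ) (c + δ) := ⟨by linarith, by linarith⟩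
    have b0 : ∀ t ∈ Ioo (c - δ) (c + δ), β t = 0 := by
      refine eqOn_zero_of_hasDerivAt_mul hcc (φ := φ) (K := |φ c| + 1) ?_
        (fun t ht => (hδs t ht).2.2.le) hcβ
      intro t ht
      obtain ⟨hI, hne, -⟩ := hδs t ht
      convert hβ t using 1
      have e2 := h2 t hI
      have e1 := h1 t hI
      have eγ : γ t = β t ^ 2 / α t := by field_simp; linarith
      have : g t = (2 * β t * b t - p t * γ t) / α t := by field_simp; linarith
      rw [this, eγ, hφ]; field_simp
    have g0 : ∀ t ∈ Ioo (c - δ) (c + δ), γ t = 0 := by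
      intro t ht
      obtain ⟨hI, hne, -⟩ := hδs t ht
      have e1 := h1 t hI
      rw [b0 t ht] at e1
      simpa [hne] using e1
    have k0 : ∀ t ∈ Ioo (c - δ) (c + δ), k t = 2 * b t ^ 2 / α t := by
      intro t ht
      obtain ⟨hI, hne, -⟩ := hδs t ht
      have e2 := h2 t hI
      have e3 := h3 t hI
      rw [b0 t ht, g0 t ht] at e2 e3
      have : g t = 0 := by simpa [hne] using e2
      rw [this] at e3
      field_simp; linarith
    have q0 : ∀ t ∈ Ioo (c - δ) (c + δ), b t / α t ^ 2 = b c / α c ^ 2 := by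
      refine eq_of_hasDerivAt_zero (g := fun t => b t / α t ^ 2) hcc ?_
      intro t ht
      obtain ⟨hI, hne, -⟩ := hδs t ht
      refine HasDerivAt.congr_deriv ((hb t).div ((hα t).pow 2) (pow_ne_zero 2 hne)) ?_
      rw [k0 t ht]; field_simp; ring
    have hκc : b c / α c ^ 2 = κ := by rw [hcb]; field_simp
    have i0 : ∀ t ∈ Ioo (c - δ) (c + δ), (α t)⁻¹ + κ * t = (α c)⁻¹ + κ * c := by
      refine eq_of_hasDerivAt_zero (g := fun t => (α t)⁻¹ + κ * t) hcc ?_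
      intro t ht
      obtain ⟨hI, hne, -⟩ := hδs t ht
      refine HasDerivAt.congr_deriv ((hα t).inv hne |>.add ((hasDerivAt_id t).const_mul κ)) ?_
      rw [← hκc, ← q0 t ht]; field_simp; ring
    have hic : (α c)⁻¹ + κ * c = 1 / α 0 := by
      have : (α c)⁻¹ = 1 / α 0 - κ * c := by
        exact inv_eq_of_mul_eq_one_right hcα
      rw [this]; ring
    rw [mem_nhds_iff]
    refine ⟨Ioo (c - δ) (c + δ), ?_, isOpen_Ioo, hcc⟩
    intro t ht
    obtain ⟨hI, hne, -⟩ := hδs t ht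
    refine ⟨b0 t ht, ?_, ?_⟩
    · have := (q0 t ht).trans hκc
      field_simp at this; linarith
    · have := (i0 t ht).trans hic
      rw [← this]; field_simp; ring
  have hsub : Ioo t₀ t₁ ⊆ Z := by
    refine isPreconnected_Ioo.subset_of_closure_inter_subset (u := interior Z) isOpen_interior
      ⟨0, h0, mem_interior_iff_mem_nhds.2 (hopen 0 ⟨h0, hZ0⟩)⟩ ?_ |>.trans interior_subset
    rintro x ⟨hx, hxI⟩
    exact mem_interior_iff_mem_nhds.2 (hopen x ⟨hxI, hZc.closure_subset_iff.2 interior_subset hx⟩)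
  intro t ht
  obtain ⟨e1, e2, e3⟩ := hsub ht
  have hne : α t ≠ 0 := by intro h; rw [h] at e3; simp at e3
  refine ⟨hne, e1, ?_⟩
  have := h1 t ht
  rw [e1] at this
  simpa [hne] using this

/-! ### Directional derivatives in the plane -/

section DirectionalDerivative

variable {F : Type*} [NormedAddCommGroup F]

/-- The derivative of `g` in the constant direction `v`, as a function. -/
noncomputable def pd [NormedSpace ℝ F] (v : ℝ × ℝ) (g : ℝ × ℝ → F) (p : ℝ × ℝ) : F :=
  fderiv ℝ g p v

section Normed

variable [NormedSpace ℝ F] {g h : ℝ × ℝ → F}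

theorem ContDiff.pd (hg : ContDiff ℝ ∞ g) (v : ℝ × ℝ) : ContDiff ℝ ∞ (pd v g) :=
  (hg.fderiv_right (m := ∞) (by simp)).clm_apply contDiff_const

theorem ContDiff.pd_pd (hg : ContDiff ℝ ∞ g) (v w p : ℝ × ℝ) :
    _root_.pd v (_root_.pd w g) p = fderiv ℝ (fderiv ℝ g) p v w := by
  have hd : DifferentiableAt ℝ (fderiv ℝ g) p :=
    (hg.fderiv_right (m := ∞) (by simp)).differentiable (by simp) p
  unfold _root_.pd
  rw [fderiv_clm_apply hd (differentiableAt_const w)]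
  simp

theorem ContDiff.pd_comm (hg : ContDiff ℝ ∞ g) (v w : ℝ × ℝ) :
    _root_.pd v (_root_.pd w g) = _root_.pd w (_root_.pd v g) := by
  funext p
  rw [hg.pd_pd, hg.pd_pd]
  exact (hg.contDiffAt (x := p)).isSymmSndFDerivAt
    (by rw [minSmoothness_of_isRCLikeNormedField]
        exact WithTop.coe_le_coe.2 (le_top (a := (2 : ℕ∞)))) v w

theorem ContDiff.hasDerivAt_line (hg : ContDiff ℝ ∞ g) (q v : ℝ × ℝ) (t : ℝ) :
    HasDerivAt (fun t : ℝ => g (q + t • v)) (_root_.pd v g (q + t • v)) t := by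
  have h1 : HasDerivAt (fun t : ℝ => q + t • v) v t := by
    simpa using ((hasDerivAt_id t).smul_const v).const_add q
  exact ((hg.differentiable (by simp)) (q + t • v)).hasFDerivAt.comp_hasDerivAt t h1

theorem pd_eqOn {U : Set (ℝ × ℝ)} (hU : IsOpen U) (hgh : EqOn g h U) (v : ℝ × ℝ) :
    EqOn (pd v g) (pd v h) U := by
  intro p hp
  have : g =ᶠ[𝓝 p] h := Filter.eventually_of_mem (hU.mem_nhds hp) hgh
  simp [pd, this.fderiv_eq]

end Normed

variable [InnerProductSpace ℝ F] {g h : ℝ × ℝ → F}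

theorem ContDiff.pd_inner (hg : ContDiff ℝ ∞ g) (hh : ContDiff ℝ ∞ h) (v p : ℝ × ℝ) :
    _root_.pd v (fun q => ⟪g q, h q⟫) p =
      ⟪g p, _root_.pd v h p⟫ + ⟪_root_.pd v g p, h p⟫ := by
  unfold _root_.pd
  rw [fderiv_inner_apply ℝ ((hg.differentiable (by simp)) p) ((hh.differentiable (by simp)) p)]

theorem ContDiff.pd_inner_const (hg : ContDiff ℝ ∞ g) (e : F) (v : ℝ × ℝ) :
    _root_.pd v (fun q => ⟪g q, e⟫) = fun q => ⟪_root_.pd v g q, e⟫ := by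
  funext p
  rw [hg.pd_inner contDiff_const]
  simp [_root_.pd]

theorem ContDiff.pd_mul {a b : ℝ × ℝ → ℝ} (ha : ContDiff ℝ ∞ a) (hb : ContDiff ℝ ∞ b)
    (v p : ℝ × ℝ) :
    _root_.pd v (fun q => a q * b q) p = a p * _root_.pd v b p + b p * _root_.pd v a p := by
  unfold _root_.pd
  rw [fderiv_fun_mul ((ha.differentiable (by simp)) p) ((hb.differentiable (by simp)) p)]
  simp

end DirectionalDerivative

/-- If the Hessian of `u` is degenerate on `U`, then the direction `v` of its kernel at `q` stays in
the kernel along the line through `q` with direction `v`. -/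
theorem degenerate_hessian_kernel_line {u : ℝ × ℝ → ℝ} (hu : ContDiff ℝ ∞ u) {U : Set (ℝ × ℝ)}
    (hU : IsOpen U) {q w v : ℝ × ℝ}
    (hdet : ∀ p ∈ U, pd w (pd w u) p * pd v (pd v u) p = pd w (pd v u) p ^ 2)
    {t₀ t₁ : ℝ} (h0 : (0 : ℝ) ∈ Ioo t₀ t₁) (hI : ∀ t ∈ Ioo t₀ t₁, q + t • v ∈ U)
    (hw : pd w (pd w u) q ≠ 0) (hv : pd w (pd v u) q = 0) :
    ∀ t ∈ Ioo t₀ t₁, pd w (pd w u) (q + t • v) ≠ 0 ∧ pd v (pd v u) (q + t • v) = 0 := by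
  have cww := (hu.pd w).pd w
  have cwv := (hu.pd v).pd w
  have cvv := (hu.pd v).pd v
  set A := pd w (pd w u) with hA
  set B := pd w (pd v u) with hB
  set C := pd v (pd v u) with hC
  have hAB : pd v A = pd w B := by
    rw [hA, hB, (hu.pd w).pd_comm v w, hu.pd_comm v w]
  have hBC : pd v B = pd w C := by
    rw [hB, hC, (hu.pd v).pd_comm v w]
  have hBC' : pd v (pd w B) = pd w (pd w C) := by
    rw [cwv.pd_comm v w, hBC]
  have d1 : EqOn (fun p => A p * C p) (fun p => B p * B p) U := fun p hp => by
    simpa only [sq] using hdet p hp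
  have d2 : EqOn (fun p => A p * pd w C p + C p * pd w A p)
      (fun p => B p * pd w B p + B p * pd w B p) U := by
    intro p hp
    have := pd_eqOn hU d1 w hp
    rwa [cww.pd_mul cvv, cwv.pd_mul cwv] at this
  have d3 : ∀ p ∈ U, (A p * pd w (pd w C) p + pd w C p * pd w A p) +
      (C p * pd w (pd w A) p + pd w A p * pd w C p) =
      2 * (B p * pd w (pd w B) p + pd w B p * pd w B p) := by
    intro p hp
    have := pd_eqOn hU d2 w hp
    have e1 : ∀ (a b : ℝ × ℝ → ℝ), ContDiff ℝ ∞ a → ContDiff ℝ ∞ b →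
        pd w (fun p => a p + b p) p = pd w a p + pd w b p := by
      intro a b ha hb
      unfold pd
      rw [fderiv_fun_add (ha.differentiable (by simp) p) (hb.differentiable (by simp) p)]
      simp
    rw [e1 _ _ (cww.mul (cvv.pd w)) (cvv.mul (cww.pd w)),
      e1 _ _ (cwv.mul (cwv.pd w)) (cwv.mul (cwv.pd w)), cww.pd_mul (cvv.pd w),
      cvv.pd_mul (cww.pd w), cwv.pd_mul (cwv.pd w)] at this
    linarith
  have hline : Continuous fun t : ℝ => q + t • v := by fun_prop
  have main := degenerate_hessian_line (α := fun t => A (q + t • v)) (β := fun t => B (q + t • v))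
    (γ := fun t => C (q + t • v)) (b := fun t => pd w B (q + t • v))
    (g := fun t => pd w C (q + t • v)) (k := fun t => pd w (pd w C) (q + t • v))
    (p := fun t => pd w A (q + t • v)) (r := fun t => pd w (pd w A) (q + t • v))
    (m := fun t => pd w (pd w B) (q + t • v)) h0
    (fun t => hAB ▸ cww.hasDerivAt_line q v t) (fun t => hBC ▸ cwv.hasDerivAt_line q v t)
    (fun t => hBC' ▸ (cwv.pd w).hasDerivAt_line q v t) ((cww.pd w).continuous.comp hline)
    (fun t ht => hdet _ (hI t ht))
    (fun t ht => by have := d2 (hI t ht); simp only at this; linarith)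
    (fun t ht => by have := d3 _ (hI t ht); linarith)
    (by simpa using hw) (by simpa using hv)
  exact fun t ht => ⟨(main t ht).1, (main t ht).2.2⟩

/-! ### Flat isometric immersions of a strip -/

theorem exists_unit_normal {g₁ g₂ : E3} (h₁ : ‖g₁‖ = 1) (h₂ : ‖g₂‖ = 1) (h₁₂ : ⟪g₁, g₂⟫ = 0) :
    ∃ n : E3, ‖n‖ = 1 ∧ ∀ X : E3, ⟪g₁, X⟫ = 0 → ⟪g₂, X⟫ = 0 → X = ⟪X, n⟫ • n := by
  have ho : Orthonormal ℝ ![g₁, g₂] := by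
    rw [orthonormal_iff_ite]
    intro i j
    fin_cases i <;> fin_cases j <;> simp [h₁, h₂, h₁₂, real_inner_comm]
  set S := Submodule.span ℝ (Set.range ![g₁, g₂]) with hS
  have hfin : Module.finrank ℝ S = 2 := by
    have := finrank_span_eq_card ho.linearIndependent
    simpa using this
  have hperp : Module.finrank ℝ Sᗮ = 1 := by
    have := Submodule.finrank_add_finrank_orthogonal S
    rw [hfin, finrank_euclideanSpace_fin] at this
    omega
  obtain ⟨n, hn, hspan⟩ := finrank_eq_one_iff'.1 hperp
  have hn0 : (n : E3) ≠ 0 := by simpa using hn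
  have hnn : ‖(n : E3)‖ ≠ 0 := norm_ne_zero_iff.2 hn0
  refine ⟨‖(n : E3)‖⁻¹ • (n : E3), ?_, ?_⟩
  · rw [norm_smul, norm_inv, norm_norm, inv_mul_cancel₀ hnn]
  · intro X h1 h2
    have hX : X ∈ Sᗮ := by
      rw [Submodule.mem_orthogonal]
      intro u hu
      induction hu using Submodule.span_induction with
      | mem x hx =>
        obtain ⟨i, rfl⟩ := hx
        fin_cases i <;> simp [h1, h2]
      | zero => simp
      | add x y _ _ hx hy => rw [inner_add_left, hx, hy, add_zero]
      | smul a x _ hx => rw [inner_smul_left, hx, mul_zero]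
    obtain ⟨c, hc⟩ := hspan ⟨X, hX⟩
    have hc' : X = c • (n : E3) := by rw [← Submodule.coe_smul, hc]
    rw [hc', inner_smul_left, inner_smul_right, real_inner_self_eq_norm_sq, smul_smul]
    congr 1
    simp; field_simp

/-- The open strip of width one. -/
def openStrip : Set (ℝ × ℝ) := {p | p.2 ∈ Ioo (0 : ℝ) 1}

theorem isOpen_openStrip : IsOpen openStrip := isOpen_Ioo.preimage continuous_snd

section Flat

variable {G : ℝ × ℝ → E3} (hG : ContDiff ℝ ∞ G)
  (hiso : ∀ p ∈ openStrip, ∀ v : ℝ × ℝ, ‖pd v G p‖ = √(v.1 ^ 2 + v.2 ^ 2))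

include hiso in
theorem inner_pd_pd {p : ℝ × ℝ} (hp : p ∈ openStrip) (v w : ℝ × ℝ) :
    ⟪pd v G p, pd w G p⟫ = v.1 * w.1 + v.2 * w.2 := by
  have hadd : pd v G p + pd w G p = pd (v + w) G p := by simp [pd]
  rw [real_inner_eq_norm_add_mul_self_sub_norm_mul_self_sub_norm_mul_self_div_two, hadd, hiso p hp,
    hiso p hp, hiso p hp, Real.mul_self_sqrt (by positivity), Real.mul_self_sqrt (by positivity),
    Real.mul_self_sqrt (by positivity)]
  simp only [Prod.fst_add, Prod.snd_add]
  ring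

include hG hiso

theorem inner_pd_pd_pd {p : ℝ × ℝ} (hp : p ∈ openStrip) (v w z : ℝ × ℝ) :
    ⟪pd v (pd w G) p, pd z G p⟫ = 0 := by
  have anti : ∀ v w z : ℝ × ℝ,
      ⟪pd w G p, pd v (pd z G) p⟫ + ⟪pd v (pd w G) p, pd z G p⟫ = 0 := by
    intro v w z
    have h : EqOn (fun q => ⟪pd w G q, pd z G q⟫) (fun _ => w.1 * z.1 + w.2 * z.2) openStrip :=
      fun q hq => inner_pd_pd hiso hq w z
    rw [← (hG.pd w).pd_inner (hG.pd z), pd_eqOn isOpen_openStrip h v hp]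
    simp [pd]
  have e1 := anti v w z
  have e2 := anti z v w
  have e3 := anti w z v
  rw [real_inner_comm] at e1 e2 e3
  rw [hG.pd_comm z v] at e2
  rw [hG.pd_comm w z, hG.pd_comm w v] at e3
  linarith

theorem gauss_equation {p : ℝ × ℝ} (hp : p ∈ openStrip) (v w : ℝ × ℝ) :
    ⟪pd w (pd w G) p, pd v (pd v G) p⟫ = ⟪pd w (pd v G) p, pd w (pd v G) p⟫ := by
  have key : ∀ y v w z : ℝ × ℝ,
      ⟪pd v (pd w G) p, pd y (pd z G) p⟫ + ⟪pd y (pd v (pd w G)) p, pd z G p⟫ = 0 := by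
    intro y v w z
    have h : EqOn (fun q => ⟪pd v (pd w G) q, pd z G q⟫) (fun _ => 0) openStrip :=
      fun q hq => inner_pd_pd_pd hG hiso hq v w z
    rw [← ((hG.pd w).pd v).pd_inner (hG.pd z), pd_eqOn isOpen_openStrip h y hp]
    simp [pd]
  have e1 := key v w w v
  have e2 := key w w v v
  rw [(hG.pd w).pd_comm v w, hG.pd_comm v w] at e1
  linarith

/-- The second derivatives at a point are multiples of a unit normal. -/
theorem exists_normal {p : ℝ × ℝ} (hp : p ∈ openStrip) :
    ∃ n : E3, ‖n‖ = 1 ∧ ∀ v w, pd v (pd w G) p = ⟪pd v (pd w G) p, n⟫ • n := by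
  obtain ⟨n, hn, h⟩ := exists_unit_normal (g₁ := pd (1, 0) G p) (g₂ := pd (0, 1) G p)
    (by rw [hiso p hp]; simp) (by rw [hiso p hp]; simp) (by rw [inner_pd_pd hiso hp]; simp)
  refine ⟨n, hn, fun v w => h _ ?_ ?_⟩
  · rw [real_inner_comm]; exact inner_pd_pd_pd hG hiso hp v w _
  · rw [real_inner_comm]; exact inner_pd_pd_pd hG hiso hp v w _

theorem second_fundamental_form_det {p : ℝ × ℝ} (hp : p ∈ openStrip) (v w : ℝ × ℝ) (n : E3)
    (hn : ‖n‖ = 1) (h : ∀ v w, pd v (pd w G) p = ⟪pd v (pd w G) p, n⟫ • n) :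
    ⟪pd w (pd w G) p, n⟫ * ⟪pd v (pd v G) p, n⟫ = ⟪pd w (pd v G) p, n⟫ ^ 2 := by
  have := gauss_equation hG hiso hp v w
  rw [h w w, h v v, h w v] at this
  simp only [inner_smul_left, inner_smul_right, real_inner_self_eq_norm_sq, hn] at this
  simp only [conj_trivial] at this
  linarith

theorem hessian_inner_det {p : ℝ × ℝ} (hp : p ∈ openStrip) (v w : ℝ × ℝ) (e : E3) :
    ⟪pd w (pd w G) p, e⟫ * ⟪pd v (pd v G) p, e⟫ = ⟪pd w (pd v G) p, e⟫ ^ 2 := by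
  obtain ⟨n, hn, h⟩ := exists_normal hG hiso hp
  have := second_fundamental_form_det hG hiso hp v w n hn h
  rw [h w w, h v v, h w v]
  simp only [inner_smul_left, conj_trivial]
  linear_combination ⟪n, e⟫ ^ 2 * this

/-- At a point that is not flat there is a direction in the kernel of the second fundamental form,
and it may be normalised to be horizontal or to have height one. -/
theorem exists_kernel_direction {p : ℝ × ℝ} (hp : p ∈ openStrip) {v₀ : ℝ × ℝ}
    (hv₀ : pd v₀ (pd v₀ G) p ≠ 0) :
    ∃ w v : ℝ × ℝ, pd w (pd w G) p ≠ 0 ∧ pd w (pd v G) p = 0 ∧ (v = (1, 0) ∨ ∃ c, v = (c, 1)) := by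
  obtain ⟨n, hn, h⟩ := exists_normal hG hiso hp
  have hdet := second_fundamental_form_det hG hiso hp (0, 1) (1, 0) n hn h
  set α := ⟪pd (1, 0) (pd (1, 0) G) p, n⟫ with hα
  set β := ⟪pd (1, 0) (pd (0, 1) G) p, n⟫ with hβ
  set γ := ⟪pd (0, 1) (pd (0, 1) G) p, n⟫ with hγ
  have hlin : ∀ (z : ℝ × ℝ) (c d : ℝ),
      pd z (pd (c, d) G) p = c • pd z (pd (1, 0) G) p + d • pd z (pd (0, 1) G) p := by
    intro z c d
    have : ((c, d) : ℝ × ℝ) = c • ((1, 0) : ℝ × ℝ) + d • ((0, 1) : ℝ × ℝ) := by simp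
    rw [this, hG.pd_pd, hG.pd_pd, hG.pd_pd, map_add, map_smul, map_smul]
  by_cases hα0 : α = 0
  · have hβ0 : β = 0 := by rw [hα0] at hdet; simpa using hdet.symm
    have hγ0 : γ ≠ 0 := by
      intro hγ0
      apply hv₀
      have hz : pd (1, 0) (pd (1, 0) G) p = 0 ∧ pd (1, 0) (pd (0, 1) G) p = 0 ∧
          pd (0, 1) (pd (0, 1) G) p = 0 := by
        refine ⟨?_, ?_, ?_⟩
        · rw [h, ← hα, hα0, zero_smul]
        · rw [h, ← hβ, hβ0, zero_smul]
        · rw [h, ← hγ, hγ0, zero_smul]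
      have e : v₀ = (v₀.1, v₀.2) := rfl
      rw [e, hlin, hG.pd_comm (v₀.1, v₀.2) (1, 0), hG.pd_comm (v₀.1, v₀.2) (0, 1), hlin (1, 0) v₀.1,
        hlin (0, 1) v₀.1, hG.pd_comm (0, 1) (1, 0), hz.1, hz.2.1, hz.2.2]
      simp
    refine ⟨(0, 1), (1, 0), ?_, ?_, Or.inl rfl⟩
    · intro h0; apply hγ0; rw [hγ, h0, inner_zero_left]
    · rw [hG.pd_comm, h, ← hβ, hβ0, zero_smul]
  · refine ⟨(1, 0), (-β / α, 1), ?_, ?_, Or.inr ⟨_, rfl⟩⟩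
    · intro h0; apply hα0; rw [hα, h0, inner_zero_left]
    · rw [hlin, h (1, 0) (1, 0), h (1, 0) (0, 1), ← hα, ← hβ, smul_smul, one_smul, ← add_smul]
      rw [div_mul_cancel₀ _ hα0]; simp

omit hiso in
theorem affine_of_second_derivative_zero {q v : ℝ × ℝ} {t₀ t₁ c : ℝ} (hc : c ∈ Ioo t₀ t₁)
    (h : ∀ t ∈ Ioo t₀ t₁, pd v (pd v G) (q + t • v) = 0) :
    ∀ t ∈ Icc t₀ t₁, G (q + t • v) = G (q + c • v) + (t - c) • pd v G (q + c • v) := by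
  have h1 : ∀ t ∈ Ioo t₀ t₁, pd v G (q + t • v) = pd v G (q + c • v) := by
    intro t ht
    exact isOpen_Ioo.is_const_of_deriv_eq_zero isPreconnected_Ioo
      (fun x _ => ((hG.pd v).hasDerivAt_line q v x).differentiableAt.differentiableWithinAt)
      (fun x hx => by rw [((hG.pd v).hasDerivAt_line q v x).deriv]; exact h x hx) ht hc
  have hd : ∀ t, HasDerivAt (fun t : ℝ => G (q + t • v) - (t - c) • pd v G (q + c • v))
      (pd v G (q + t • v) - pd v G (q + c • v)) t := by
    intro t
    refine (hG.hasDerivAt_line q v t).sub ?_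
    simpa using ((hasDerivAt_id t).sub_const c).smul_const (pd v G (q + c • v))
  have h2 : ∀ t ∈ Ioo t₀ t₁, G (q + t • v) - (t - c) • pd v G (q + c • v) = G (q + c • v) := by
    intro t ht
    have := isOpen_Ioo.is_const_of_deriv_eq_zero isPreconnected_Ioo
      (fun x _ => (hd x).differentiableAt.differentiableWithinAt)
      (fun x hx => by rw [(hd x).deriv, h1 x hx, sub_self]; rfl) ht hc
    simpa using this
  have hcont : Continuous fun t : ℝ => G (q + t • v) - (t - c) • pd v G (q + c • v) :=
    continuous_iff_continuousAt.2 fun t => (hd t).continuousAt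
  intro t ht
  rw [← closure_Ioo (hc.1.trans hc.2).ne] at ht
  have := (isClosed_eq hcont continuous_const).closure_subset_iff.2 h2 ht
  rw [← sub_eq_iff_eq_add]
  exact this

theorem affine_of_kernel_direction {q w v : ℝ × ℝ} (hw : pd w (pd w G) q ≠ 0)
    (hv : pd w (pd v G) q = 0) {t₀ t₁ : ℝ} (h0 : (0 : ℝ) ∈ Ioo t₀ t₁)
    (hI : ∀ t ∈ Ioo t₀ t₁, q + t • v ∈ openStrip) :
    ∀ t ∈ Icc t₀ t₁, G (q + t • v) = G q + t • pd v G q := by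
  have main : ∀ t ∈ Ioo t₀ t₁, pd v (pd v G) (q + t • v) = 0 := by
    set e := pd w (pd w G) q with he
    have hu : ContDiff ℝ ∞ fun p => ⟪G p, e⟫ := hG.inner ℝ contDiff_const
    have e1 : ∀ v w, pd v (pd w fun p => ⟪G p, e⟫) = fun p => ⟪pd v (pd w G) p, e⟫ := by
      intro v w
      rw [hG.pd_inner_const, (hG.pd w).pd_inner_const]
    have := degenerate_hessian_kernel_line hu isOpen_openStrip (q := q) (w := w) (v := v)
      (by intro p hp; simp only [e1]; exact hessian_inner_det hG hiso hp v w e) h0 hI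
      (by simp only [e1]; rw [← he]; simpa using hw) (by simp only [e1]; rw [hv]; simp)
    intro t ht
    obtain ⟨hA, hC⟩ := this t ht
    simp only [e1] at hA hC
    obtain ⟨n, hn, h⟩ := exists_normal hG hiso (hI t ht)
    rw [h w w, inner_smul_left] at hA
    rw [h v v, inner_smul_left] at hC
    have hne : ⟪n, e⟫ ≠ 0 := right_ne_zero_of_mul hA
    rw [h v v]
    have := (mul_eq_zero.1 hC).resolve_right hne
    simp only [conj_trivial] at this
    rw [this, zero_smul]
  have := affine_of_second_derivative_zero hG h0 main
  simpa using this

end Flat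

/-! ### Paper bands and their bends -/

/-- A smooth embedded paper Moebius band of aspect ratio `lam`, as a map on the universal cover of
the flat band. -/
structure IsPaperBand (lam : ℝ) (G : ℝ × ℝ → E3) : Prop where
  pos : 0 < lam
  smooth : ContDiff ℝ ∞ G
  glue : ∀ x : ℝ, ∀ y ∈ Icc (0 : ℝ) 1, G (x + lam, 1 - y) = G (x, y)
  isom : ∀ p : ℝ × ℝ, p.2 ∈ Icc (0 : ℝ) 1 → ∀ v : ℝ × ℝ, ‖pd v G p‖ = √(v.1 ^ 2 + v.2 ^ 2)
  inj : ∀ x₁ x₂ y₁ y₂ : ℝ, x₁ ∈ Ico (0 : ℝ) lam → x₂ ∈ Ico (0 : ℝ) lam → y₁ ∈ Icc (0 : ℝ) 1 →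
    y₂ ∈ Icc (0 : ℝ) 1 → G (x₁, y₁) = G (x₂, y₂) → x₁ = x₂ ∧ y₁ = y₂

/-- The segment from `(a, 0)` to `(b, 1)` is mapped isometrically to a straight segment. -/
def IsBend (G : ℝ × ℝ → E3) (a b : ℝ) : Prop :=
  ‖G (b, 1) - G (a, 0)‖ = √((b - a) ^ 2 + 1)

theorem norm_sub_convex_combination_sq (x y z : E3) (t : ℝ) :
    ‖z - (x + t • (y - x))‖ ^ 2 =
      (1 - t) * ‖z - x‖ ^ 2 + t * ‖z - y‖ ^ 2 - t * (1 - t) * ‖y - x‖ ^ 2 := by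
  have e1 : z - (x + t • (y - x)) = (1 - t) • (z - x) + t • (z - y) := by module
  have e2 : y - x = (z - x) - (z - y) := by abel
  have e3 : ‖y - x‖ ^ 2 = ‖z - x‖ ^ 2 - 2 * ⟪z - x, z - y⟫ + ‖z - y‖ ^ 2 := by
    rw [e2, norm_sub_sq_real]
  rw [e1, e3, norm_add_sq_real, norm_smul, norm_smul, inner_smul_left, inner_smul_right, mul_pow,
    mul_pow, Real.norm_eq_abs, Real.norm_eq_abs, sq_abs, sq_abs]
  simp only [conj_trivial]
  ring

theorem eq_convex_combination_of_norm_le {x y z : E3} {t ℓ : ℝ} (ht : t ∈ Icc (0 : ℝ) 1)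
    (hx : ‖z - x‖ ≤ t * ℓ) (hy : ‖z - y‖ ≤ (1 - t) * ℓ) (hxy : ‖y - x‖ = ℓ) :
    z = x + t • (y - x) := by
  have h1 : ‖z - x‖ ^ 2 ≤ (t * ℓ) ^ 2 := by gcongr
  have h2 : ‖z - y‖ ^ 2 ≤ ((1 - t) * ℓ) ^ 2 := by gcongr
  have h3 : ‖z - (x + t • (y - x))‖ ^ 2 ≤ 0 := by
    rw [norm_sub_convex_combination_sq, hxy]
    nlinarith [mul_le_mul_of_nonneg_left h1 (sub_nonneg.2 ht.2), mul_le_mul_of_nonneg_left h2 ht.1]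
  have h4 : ‖z - (x + t • (y - x))‖ = 0 := by
    have := sq_nonneg ‖z - (x + t • (y - x))‖
    exact pow_eq_zero_iff (two_ne_zero) |>.1 (le_antisymm h3 this)
  exact sub_eq_zero.1 (norm_eq_zero.1 h4)

namespace IsPaperBand

variable {lam : ℝ} {G : ℝ × ℝ → E3} (H : IsPaperBand lam G)
include H

theorem norm_sub_le {p q : ℝ × ℝ} (hp : p.2 ∈ Icc (0 : ℝ) 1) (hq : q.2 ∈ Icc (0 : ℝ) 1) :
    ‖G q - G p‖ ≤ √((q.1 - p.1) ^ 2 + (q.2 - p.2) ^ 2) := by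
  have hmem : ∀ t ∈ Icc (0 : ℝ) 1, (p + t • (q - p)).2 ∈ Icc (0 : ℝ) 1 := by
    intro t ht
    have := (convex_Icc (0 : ℝ) 1).add_smul_sub_mem hp hq ht
    simpa using this
  have := norm_image_sub_le_of_norm_deriv_le_segment_01' (f := fun t : ℝ => G (p + t • (q - p)))
    (f' := fun t => pd (q - p) G (p + t • (q - p))) (C := √((q.1 - p.1) ^ 2 + (q.2 - p.2) ^ 2))
    (fun t _ => (H.smooth.hasDerivAt_line p (q - p) t).hasDerivWithinAt)
    (fun t ht => (H.isom _ (hmem t ⟨ht.1, ht.2.le⟩) _).le)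
  simpa using this

theorem affine_of_norm_eq {p q : ℝ × ℝ} (hp : p.2 ∈ Icc (0 : ℝ) 1) (hq : q.2 ∈ Icc (0 : ℝ) 1)
    (h : ‖G q - G p‖ = √((q.1 - p.1) ^ 2 + (q.2 - p.2) ^ 2)) {t : ℝ} (ht : t ∈ Icc (0 : ℝ) 1) :
    G (p + t • (q - p)) = G p + t • (G q - G p) := by
  have hmem : (p + t • (q - p)).2 ∈ Icc (0 : ℝ) 1 := by
    have := (convex_Icc (0 : ℝ) 1).add_smul_sub_mem hp hq ht
    simpa using this
  refine eq_convex_combination_of_norm_le ht ?_ ?_ h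
  · refine (H.norm_sub_le hp hmem).trans_eq ?_
    have : t = √(t ^ 2) := (Real.sqrt_sq ht.1).symm
    conv_rhs => rw [this, ← Real.sqrt_mul (sq_nonneg _)]
    congr 1; simp; ring
  · refine (H.norm_sub_le hq hmem).trans_eq ?_
    have : 1 - t = √((1 - t) ^ 2) := (Real.sqrt_sq (sub_nonneg.2 ht.2)).symm
    conv_rhs => rw [this, ← Real.sqrt_mul (sq_nonneg _)]
    congr 1; simp; ring

theorem bend_apply {a b t : ℝ} (h : IsBend G a b) (ht : t ∈ Icc (0 : ℝ) 1) :
    G ((1 - t) * a + t * b, t) = G (a, 0) + t • (G (b, 1) - G (a, 0)) := by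
  have := H.affine_of_norm_eq (p := (a, 0)) (q := (b, 1)) (by simp) (by simp)
    (by simpa [IsBend] using h) ht
  rw [← this]
  congr 1
  ext <;> simp; ring

theorem pd_bend {a b t : ℝ} (h : IsBend G a b) (ht : t ∈ Ioo (0 : ℝ) 1) :
    pd (b - a, 1) G ((1 - t) * a + t * b, t) = G (b, 1) - G (a, 0) := by
  have h1 := H.smooth.hasDerivAt_line (a, 0) (b - a, 1) t
  have e : (a, (0 : ℝ)) + t • (b - a, (1 : ℝ)) = ((1 - t) * a + t * b, t) := by
    ext <;> simp; ring
  rw [e] at h1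
  have h2 : HasDerivAt (fun t : ℝ => G (a, 0) + t • (G (b, 1) - G (a, 0)))
      (G (b, 1) - G (a, 0)) t := by
    simpa using ((hasDerivAt_id t).smul_const (G (b, 1) - G (a, 0))).const_add (G (a, 0))
  refine h1.unique (h2.congr_of_eventuallyEq ?_)
  filter_upwards [Ioo_mem_nhds ht.1 ht.2] with s hs
  rw [← H.bend_apply h ⟨hs.1.le, hs.2.le⟩]
  congr 1
  ext <;> simp; ring

/-- If two bends cross, then all the segments between them are bends. -/
theorem isBend_of_crossing {a₁ b₁ a₂ b₂ a b : ℝ} (h₁ : IsBend G a₁ b₁) (h₂ : IsBend G a₂ b₂)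
    (ha : a₁ < a₂) (hb : b₂ < b₁) (ha' : a ∈ Icc a₁ a₂) (hb' : b ∈ Icc b₂ b₁) : IsBend G a b := by
  set y := (a₂ - a₁) / ((a₂ - a₁) + (b₁ - b₂)) with hy
  have hpos : 0 < (a₂ - a₁) + (b₁ - b₂) := by linarith
  have hy1 : y * ((a₂ - a₁) + (b₁ - b₂)) = a₂ - a₁ := div_mul_cancel₀ _ hpos.ne'
  have hyI : y ∈ Ioo (0 : ℝ) 1 := ⟨div_pos (by linarith) hpos, by
    rw [hy, div_lt_one hpos]; linarith⟩
  have hyI' : y ∈ Icc (0 : ℝ) 1 := ⟨hyI.1.le, hyI.2.le⟩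
  set x := (1 - y) * a₁ + y * b₁ with hx
  have hx2 : (1 - y) * a₂ + y * b₂ = x := by rw [hx]; linarith
  set D := fderiv ℝ G (x, y) with hD
  have hDn : ∀ v, ‖D v‖ = √(v.1 ^ 2 + v.2 ^ 2) := fun v => H.isom (x, y) hyI' v
  have hD1 : D (b₁ - a₁, 1) = G (b₁, 1) - G (a₁, 0) := H.pd_bend h₁ hyI
  have hD2 : D (b₂ - a₂, 1) = G (b₂, 1) - G (a₂, 0) := by
    have := H.pd_bend h₂ hyI
    rwa [hx2] at this
  have ends : ∀ a b : ℝ, IsBend G a b → (1 - y) * a + y * b = x →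
      D (b - a, 1) = G (b, 1) - G (a, 0) →
      G (a, 0) = G (x, y) + D (a - x, -y) ∧ G (b, 1) = G (x, y) + D (b - x, 1 - y) := by
    intro a b hab hxe hDe
    have e := H.bend_apply hab hyI'
    rw [hxe] at e
    have e1 : D (a - x, -y) = (-y) • (G (b, 1) - G (a, 0)) := by
      rw [← hDe, ← map_smul]; congr 1; ext <;> simp; rw [← hxe]; ring
    have e2 : D (b - x, 1 - y) = (1 - y) • (G (b, 1) - G (a, 0)) := by
      rw [← hDe, ← map_smul]; congr 1; ext <;> simp; rw [← hxe]; ring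
    rw [e1, e2, e]
    constructor <;> module
  obtain ⟨p1, q1⟩ := ends a₁ b₁ h₁ rfl hD1
  obtain ⟨p2, q2⟩ := ends a₂ b₂ h₂ hx2 hD2
  have side : ∀ c d s : ℝ, ∀ e ∈ Icc (0 : ℝ) 1, c < d → G (c, e) = G (x, y) + D (c - x, e - y) →
      G (d, e) = G (x, y) + D (d - x, e - y) → s ∈ Icc c d →
      G (s, e) = G (x, y) + D (s - x, e - y) := by
    intro c d s e he hcd hc hd hs
    have hsub : G (d, e) - G (c, e) = D (d - c, 0) := by
      rw [hc, hd, add_sub_add_left_eq_sub, ← map_sub]; congr 1; ext <;> simp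
    have hcd0 : d - c ≠ 0 := by linarith
    have := H.affine_of_norm_eq (p := (c, e)) (q := (d, e)) he he
      (by rw [hsub, hDn]; simp) (t := (s - c) / (d - c))
      ⟨div_nonneg (by linarith [hs.1]) (by linarith),
        (div_le_one (by linarith)).2 (by linarith [hs.2])⟩
    rw [hsub, hc, ← map_smul, add_assoc, ← map_add] at this
    have e1 : (c, e) + ((s - c) / (d - c)) • ((d, e) - (c, e)) = (s, e) := by
      ext <;> simp [div_mul_cancel₀ _ hcd0]
    have e2 : (c - x, e - y) + ((s - c) / (d - c)) • (d - c, (0 : ℝ)) = (s - x, e - y) := by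
      ext <;> simp [div_mul_cancel₀ _ hcd0]
    rwa [e1, e2] at this
  have hG0 := side a₁ a₂ a 0 (by simp) ha (by simpa using p1) (by simpa using p2) ha'
  have hG1 := side b₂ b₁ b 1 (by simp) hb q2 q1 hb'
  unfold IsBend
  rw [hG0, hG1, add_sub_add_left_eq_sub, ← map_sub, hDn]
  congr 1; simp

theorem glue_zero (x : ℝ) : G (x + lam, 1) = G (x, 0) := by
  simpa using H.glue x 0 (by simp)

theorem glue_one (x : ℝ) : G (x + lam, 0) = G (x, 1) := by
  simpa using H.glue x 1 (by simp)

theorem isBend_add {a b : ℝ} : IsBend G (b + lam) (a + lam) ↔ IsBend G a b := by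
  unfold IsBend
  rw [H.glue_zero, H.glue_one, norm_sub_rev]
  ring_nf

theorem one_add_sq_le {a b : ℝ} (h : IsBend G a b) :
    (b - a) ^ 2 + 1 ≤ (lam - |b - a|) ^ 2 ∧ |b - a| < lam := by
  have hp := H.pos
  have key : ∀ c, G (c, 0) = G (b, 1) → (b - a) ^ 2 + 1 ≤ (c - a) ^ 2 := by
    intro c hc
    have := H.norm_sub_le (p := (a, 0)) (q := (c, 0)) (by simp) (by simp)
    rw [hc, show ‖G (b, 1) - G (a, 0)‖ = _ from h] at this
    have := (Real.sqrt_le_sqrt_iff (by positivity)).1 this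
    simpa using this
  have h1 := key (b + lam) (H.glue_one b)
  have h2 := key (b - lam) (by rw [← H.glue_zero]; simp)
  rcases abs_cases (b - a) with ⟨h, h'⟩ | ⟨h, h'⟩ <;> rw [h] <;> constructor <;> nlinarith

/-- A segment along which the band is flat is a bend. -/
theorem isBend_of_flat {a b : ℝ}
    (h : ∀ y ∈ Ioo (0 : ℝ) 1, pd (b - a, 1) (pd (b - a, 1) G) ((1 - y) * a + y * b, y) = 0) :
    IsBend G a b := by
  have e : ∀ t : ℝ, (a, (0 : ℝ)) + t • (b - a, (1 : ℝ)) = ((1 - t) * a + t * b, t) := by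
    intro t; ext <;> simp; ring
  have := affine_of_second_derivative_zero H.smooth (q := (a, 0)) (v := (b - a, 1)) (t₀ := 0)
    (t₁ := 1) (c := 1 / 2) (by norm_num) (by intro t ht; rw [e]; exact h t ht)
  have h0 := this 0 (by simp)
  have h1 := this 1 (by simp)
  rw [e] at h0 h1
  simp only [sub_zero, one_mul, zero_mul, add_zero, sub_self, zero_add] at h0 h1
  unfold IsBend
  rw [h0, h1, add_sub_add_left_eq_sub, ← sub_smul]
  rw [show (1 : ℝ) - 1 / 2 - (0 - 1 / 2) = 1 by norm_num, one_smul, e, H.isom _ (by norm_num)]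
  simp

theorem isom_openStrip : ∀ p ∈ openStrip, ∀ v : ℝ × ℝ, ‖pd v G p‖ = √(v.1 ^ 2 + v.2 ^ 2) :=
  fun p hp v => H.isom p ⟨hp.1.le, hp.2.le⟩ v

theorem add_two_mul (x : ℝ) {y : ℝ} (hy : y ∈ Icc (0 : ℝ) 1) : G (x + 2 * lam, y) = G (x, y) := by
  have h := H.glue (x + lam) (1 - y) ⟨by linarith [hy.2], by linarith [hy.1]⟩
  rw [H.glue x y hy] at h
  rw [← h]; congr 1; ext <;> simp; ring

/-- Every interior point of the band is flat or lies on a bend. -/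
theorem flat_or_exists_bend {x y : ℝ} (hy : y ∈ Ioo (0 : ℝ) 1) :
    (∀ v, pd v (pd v G) (x, y) = 0) ∨ ∃ a b, IsBend G a b ∧ (1 - y) * a + y * b = x := by
  by_cases hflat : ∀ v, pd v (pd v G) (x, y) = 0
  · exact Or.inl hflat
  right
  push Not at hflat
  obtain ⟨v₀, hv₀⟩ := hflat
  obtain ⟨w, v, hw, hv, hform⟩ := exists_kernel_direction H.smooth H.isom_openStrip
    (p := (x, y)) hy hv₀
  have hp := H.pos
  rcases hform with rfl | ⟨c, rfl⟩
  · exfalso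
    have := affine_of_kernel_direction H.smooth H.isom_openStrip hw hv (t₀ := -1)
      (t₁ := 2 * lam) ⟨by norm_num, by linarith⟩ (by intro t _; simpa [openStrip] using hy)
      (2 * lam) ⟨by linarith, le_rfl⟩
    have e : (x, y) + (2 * lam) • ((1, 0) : ℝ × ℝ) = (x + 2 * lam, y) := by ext <;> simp
    rw [e, H.add_two_mul x ⟨hy.1.le, hy.2.le⟩] at this
    have h0 : (2 * lam) • pd (1, 0) G (x, y) = 0 := by simpa using this.symm
    have h1 := H.isom_openStrip (x, y) hy (1, 0)
    rcases smul_eq_zero.1 h0 with h | h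
    · linarith
    · rw [h] at h1; norm_num at h1
  · have aff := affine_of_kernel_direction H.smooth H.isom_openStrip hw hv (t₀ := -y)
      (t₁ := 1 - y) ⟨by linarith [hy.1], by linarith [hy.2]⟩
      (by intro t ht; constructor <;> simp <;> linarith [ht.1, ht.2])
    have h0 := aff (-y) ⟨le_rfl, by linarith⟩
    have h1 := aff (1 - y) ⟨by linarith, le_rfl⟩
    refine ⟨x - y * c, x + (1 - y) * c, ?_, by ring⟩
    have e0 : (x, y) + (-y) • ((c, 1) : ℝ × ℝ) = (x - y * c, 0) := by ext <;> simp; ring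
    have e1 : (x, y) + (1 - y) • ((c, 1) : ℝ × ℝ) = (x + (1 - y) * c, 1) := by ext <;> simp
    rw [e0] at h0
    rw [e1] at h1
    unfold IsBend
    rw [h0, h1, add_sub_add_left_eq_sub, ← sub_smul, show 1 - y - -y = 1 by ring, one_smul,
      H.isom_openStrip _ hy]
    congr 1
    ring

end IsPaperBand

/-! ### A continuous family of bends -/

theorem isClosed_isBend {G : ℝ × ℝ → E3} (hG : Continuous G) :
    IsClosed {p : ℝ × ℝ | IsBend G p.1 p.2} := by
  unfold IsBend
  exact isClosed_eq (by fun_prop) (by fun_prop)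

/-- The midpoints of bends. -/
def bendMidpoints (G : ℝ × ℝ → E3) : Set ℝ := {m | ∃ d, IsBend G (m - d / 2) (m + d / 2)}

theorem IsBend.mem_bendMidpoints {G : ℝ × ℝ → E3} {a b : ℝ} (h : IsBend G a b) :
    (a + b) / 2 ∈ bendMidpoints G := by
  refine ⟨b - a, ?_⟩
  ring_nf
  exact h

namespace IsPaperBand

variable {lam : ℝ} {G : ℝ × ℝ → E3} (H : IsPaperBand lam G)
include H

theorem isClosed_bendMidpoints : IsClosed (bendMidpoints G) := by
  have h1 : IsClosed {p : ℝ × Icc (-lam) lam | IsBend G (p.1 - p.2 / 2) (p.1 + p.2 / 2)} :=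
    (isClosed_isBend H.smooth.continuous).preimage
      (f := fun p : ℝ × Icc (-lam) lam => (p.1 - (p.2 : ℝ) / 2, p.1 + (p.2 : ℝ) / 2))
      (by fun_prop)
  have h2 := isClosedMap_fst_of_compactSpace _ h1
  convert h2 using 1
  ext m
  constructor
  · rintro ⟨d, hd⟩
    have := (H.one_add_sq_le hd).2
    rw [show m + d / 2 - (m - d / 2) = d by ring, abs_lt] at this
    exact ⟨(m, ⟨d, this.1.le, this.2.le⟩), hd, rfl⟩
  · rintro ⟨⟨m, d⟩, hd, rfl⟩
    exact ⟨d, hd⟩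

theorem nonempty_bendMidpoints : (bendMidpoints G).Nonempty := by
  by_cases h : ∃ a b, IsBend G a b
  · obtain ⟨a, b, hab⟩ := h
    exact ⟨_, hab.mem_bendMidpoints⟩
  · refine ⟨_, (H.isBend_of_flat (a := 0) (b := 0) ?_).mem_bendMidpoints⟩
    intro y hy
    rcases H.flat_or_exists_bend (x := (1 - y) * 0 + y * 0) hy with h' | ⟨a, b, hab, _⟩
    · exact h' _
    · exact absurd ⟨a, b, hab⟩ h

theorem isBend_half_add {m d : ℝ} :
    IsBend G (m + lam - d / 2) (m + lam + d / 2) ↔ IsBend G (m - -d / 2) (m + -d / 2) := by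
  rw [← H.isBend_add (a := m - -d / 2)]
  ring_nf

theorem add_mem_bendMidpoints {m : ℝ} : m + lam ∈ bendMidpoints G ↔ m ∈ bendMidpoints G := by
  constructor
  · rintro ⟨d, hd⟩
    exact ⟨-d, H.isBend_half_add.1 hd⟩
  · rintro ⟨d, hd⟩
    exact ⟨-d, H.isBend_half_add.2 (by simpa using hd)⟩

theorem add_nat_mul_mem_bendMidpoints {m : ℝ} (n : ℕ) :
    m + n * lam ∈ bendMidpoints G ↔ m ∈ bendMidpoints G := by
  induction n with
  | zero => simp
  | succ n ih =>
    rw [← ih, ← H.add_mem_bendMidpoints (m := m + n * lam)]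
    push_cast
    ring_nf

theorem mem_bendMidpoints_of_crossing {a₁ b₁ a₂ b₂ m : ℝ} (h₁ : IsBend G a₁ b₁)
    (h₂ : IsBend G a₂ b₂) (ha : a₁ < a₂) (hb : b₂ < b₁)
    (hm : m ∈ Icc ((a₁ + b₂) / 2) ((a₂ + b₁) / 2)) : m ∈ bendMidpoints G := by
  have hpos : 0 < (a₂ - a₁) + (b₁ - b₂) := by linarith
  set t := (2 * m - (a₁ + b₂)) / ((a₂ - a₁) + (b₁ - b₂)) with ht
  have ht1 : t * ((a₂ - a₁) + (b₁ - b₂)) = 2 * m - (a₁ + b₂) := div_mul_cancel₀ _ hpos.ne'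
  have ht0 : 0 ≤ t := div_nonneg (by linarith [hm.1]) hpos.le
  have ht2 : t ≤ 1 := (div_le_one hpos).2 (by linarith [hm.2])
  have hm' : m = ((a₁ + t * (a₂ - a₁)) + (b₂ + t * (b₁ - b₂))) / 2 := by linarith
  rw [hm']
  refine (H.isBend_of_crossing h₁ h₂ ha hb ?_ ?_).mem_bendMidpoints <;> constructor <;> nlinarith

theorem bendMidpoints_eq_univ : bendMidpoints G = univ := by
  rw [eq_univ_iff_forall]
  intro m
  by_contra hm
  obtain ⟨m₀, hm₀⟩ := H.nonempty_bendMidpoints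
  have hcl := H.isClosed_bendMidpoints
  have hp := H.pos
  obtain ⟨n, hn⟩ := exists_nat_gt (|m - m₀| / lam)
  rw [div_lt_iff₀ hp] at hn
  have hlow : (bendMidpoints G ∩ Iic m).Nonempty := by
    refine ⟨m₀ - n * lam, ?_, ?_⟩
    · rw [← H.add_nat_mul_mem_bendMidpoints n]; simpa using hm₀
    · have := neg_abs_le (m - m₀); simp only [mem_Iic]; linarith
  have hup : (bendMidpoints G ∩ Ici m).Nonempty := by
    refine ⟨m₀ + n * lam, (H.add_nat_mul_mem_bendMidpoints n).2 hm₀, ?_⟩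
    have := le_abs_self (m - m₀); simp only [mem_Ici]; linarith
  have bd₁ : BddAbove (bendMidpoints G ∩ Iic m) := ⟨m, fun x hx => hx.2⟩
  have bd₂ : BddBelow (bendMidpoints G ∩ Ici m) := ⟨m, fun x hx => hx.2⟩
  have h₁ := (hcl.inter isClosed_Iic).csSup_mem hlow bd₁
  have h₂ := (hcl.inter isClosed_Ici).csInf_mem hup bd₂
  have le₁ : ∀ x ∈ bendMidpoints G, x ≤ m → x ≤ sSup (bendMidpoints G ∩ Iic m) :=
    fun x hx hxm => le_csSup bd₁ ⟨hx, hxm⟩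
  have le₂ : ∀ x ∈ bendMidpoints G, m ≤ x → sInf (bendMidpoints G ∩ Ici m) ≤ x :=
    fun x hx hxm => csInf_le bd₂ ⟨hx, hxm⟩
  set m₁ := sSup (bendMidpoints G ∩ Iic m)
  set m₂ := sInf (bendMidpoints G ∩ Ici m)
  have lt₁ : m₁ < m := lt_of_le_of_ne h₁.2 fun h => hm (h ▸ h₁.1)
  have lt₂ : m < m₂ := lt_of_le_of_ne h₂.2 fun h => hm (h ▸ h₂.1)
  obtain ⟨d₁, hd₁⟩ := h₁.1
  obtain ⟨d₂, hd₂⟩ := h₂.1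
  obtain ⟨a₁, ha₁⟩ : ∃ a₁, a₁ = m₁ - d₁ / 2 := ⟨_, rfl⟩
  obtain ⟨b₁, hb₁⟩ : ∃ b₁, b₁ = m₁ + d₁ / 2 := ⟨_, rfl⟩
  obtain ⟨a₂, ha₂⟩ : ∃ a₂, a₂ = m₂ - d₂ / 2 := ⟨_, rfl⟩
  obtain ⟨b₂, hb₂⟩ : ∃ b₂, b₂ = m₂ + d₂ / 2 := ⟨_, rfl⟩
  rw [← ha₁, ← hb₁] at hd₁
  rw [← ha₂, ← hb₂] at hd₂
  have ha : a₁ ≤ a₂ := by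
    by_contra! h
    exact hm (H.mem_bendMidpoints_of_crossing hd₂ hd₁ h (by linarith)
      ⟨by linarith, by linarith⟩)
  have hb : b₁ ≤ b₂ := by
    by_contra! h
    exact hm (H.mem_bendMidpoints_of_crossing hd₁ hd₂ (by linarith) h
      ⟨by linarith, by linarith⟩)
  have hmid : IsBend G ((a₁ + a₂) / 2) ((b₁ + b₂) / 2) := by
    refine H.isBend_of_flat fun y hy => ?_
    rcases H.flat_or_exists_bend (x := (1 - y) * ((a₁ + a₂) / 2) + y * ((b₁ + b₂) / 2)) hy with
      h | ⟨a, b, hab, hx⟩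
    · exact h _
    exfalso
    have hy0 := hy.1
    have hy1 := hy.2
    have hpos : 0 < (1 - y) * (a₂ - a₁) + y * (b₂ - b₁) := by
      rcases ha.lt_or_eq with h | h
      · have := mul_pos (sub_pos.2 hy1) (sub_pos.2 h)
        have := mul_nonneg hy0.le (sub_nonneg.2 hb)
        linarith
      · have : b₁ < b₂ := by linarith
        have := mul_pos hy0 (sub_pos.2 this)
        rw [h]; linarith
    rcases le_total ((a + b) / 2) m with hc | hc
    · have hle := le₁ _ hab.mem_bendMidpoints hc
      by_cases hc' : a₁ < a
      · have hmem := H.mem_bendMidpoints_of_crossing (m := min m ((a + b₁) / 2)) hd₁ hab hc'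
          (by linarith) ⟨le_min (by linarith) (by linarith), min_le_right _ _⟩
        have := le₁ _ hmem (min_le_left _ _)
        rcases min_choice m ((a + b₁) / 2) with h | h <;> rw [h] at this <;> linarith
      · have hb' : b₁ < b := by
          by_contra! h
          push Not at hc'
          nlinarith [mul_nonneg hy0.le (sub_nonneg.2 h),
            mul_nonneg (sub_pos.2 hy1).le (sub_nonneg.2 hc')]
        have hmem := H.mem_bendMidpoints_of_crossing (m := min m ((a₁ + b) / 2)) hab hd₁
          (by linarith) hb' ⟨le_min (by linarith) (by linarith), min_le_right _ _⟩
        have := le₁ _ hmem (min_le_left _ _)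
        rcases min_choice m ((a₁ + b) / 2) with h | h <;> rw [h] at this <;> linarith
    · have hle := le₂ _ hab.mem_bendMidpoints hc
      by_cases hc' : a < a₂
      · have hmem := H.mem_bendMidpoints_of_crossing (m := max m ((a + b₂) / 2)) hab hd₂ hc'
          (by linarith) ⟨le_max_right _ _, max_le (by linarith) (by linarith)⟩
        have := le₂ _ hmem (le_max_left _ _)
        rcases max_choice m ((a + b₂) / 2) with h | h <;> rw [h] at this <;> linarith
      · have hb' : b < b₂ := by
          by_contra! h
          push Not at hc'
          nlinarith [mul_nonneg hy0.le (sub_nonneg.2 h),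
            mul_nonneg (sub_pos.2 hy1).le (sub_nonneg.2 hc')]
        have hmem := H.mem_bendMidpoints_of_crossing (m := max m ((a₂ + b) / 2)) hd₂ hab
          (by linarith) hb' ⟨le_max_right _ _, max_le (by linarith) (by linarith)⟩
        have := le₂ _ hmem (le_max_left _ _)
        rcases max_choice m ((a₂ + b) / 2) with h | h <;> rw [h] at this <;> linarith
  have hT := hmid.mem_bendMidpoints
  rcases le_total (((a₁ + a₂) / 2 + (b₁ + b₂) / 2) / 2) m with hc | hc
  · have := le₁ _ hT hc; linarith
  · have := le₂ _ hT hc; linarith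

omit H in
/-- The differences `b - a` of the bends `(a, b)` with midpoint `m`. -/
def _root_.bendSlopes (G : ℝ × ℝ → E3) (m : ℝ) : Set ℝ := {d | IsBend G (m - d / 2) (m + d / 2)}

theorem isCompact_bendSlopes (m : ℝ) : IsCompact (bendSlopes G m) := by
  refine (isCompact_Icc (a := -lam) (b := lam)).of_isClosed_subset ?_ ?_
  · exact (isClosed_isBend H.smooth.continuous).preimage
      (f := fun d : ℝ => (m - d / 2, m + d / 2)) (by fun_prop)
  · intro d hd
    have := (H.one_add_sq_le hd).2
    rw [show m + d / 2 - (m - d / 2) = d by ring, abs_lt] at this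
    exact ⟨this.1.le, this.2.le⟩

theorem nonempty_bendSlopes (m : ℝ) : (bendSlopes G m).Nonempty := by
  have := H.bendMidpoints_eq_univ ▸ mem_univ m
  exact this

theorem ordConnected_bendSlopes (m : ℝ) : (bendSlopes G m).OrdConnected := by
  refine ⟨fun c hc d hd e he => ?_⟩
  rcases he.1.eq_or_lt with rfl | h
  · exact hc
  · exact H.isBend_of_crossing hd hc (by linarith [he.2]) (by linarith [he.2])
      ⟨by linarith [he.2], by linarith [he.1]⟩ ⟨by linarith [he.1], by linarith [he.2]⟩

theorem mem_bendSlopes_add {m d : ℝ} : d ∈ bendSlopes G (m + lam) ↔ -d ∈ bendSlopes G m :=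
  H.isBend_half_add

theorem bendSlopes_add_two_mul (m : ℝ) : bendSlopes G (m + 2 * lam) = bendSlopes G m := by
  ext d
  rw [show m + 2 * lam = m + lam + lam by ring, H.mem_bendSlopes_add, H.mem_bendSlopes_add, neg_neg]

theorem sInf_bendSlopes_le (m m' : ℝ) :
    sInf (bendSlopes G m') ≤ sSup (bendSlopes G m) + 2 * |m - m'| := by
  by_contra! hlt
  have h' := (H.isCompact_bendSlopes m').sInf_mem (H.nonempty_bendSlopes m')
  have h := (H.isCompact_bendSlopes m).sSup_mem (H.nonempty_bendSlopes m)
  have hle : ∀ e ∈ bendSlopes G m', sInf (bendSlopes G m') ≤ e :=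
    fun e he => csInf_le (H.isCompact_bendSlopes m').bddBelow he
  set d' := sInf (bendSlopes G m')
  set d := sSup (bendSlopes G m)
  have c1 := le_abs_self (m - m')
  have c2 := neg_abs_le (m - m')
  obtain ⟨η, hη⟩ : ∃ η, η = (d' - d - 2 * |m - m'|) / 2 := ⟨_, rfl⟩
  have := hle (d' - 2 * η) (H.isBend_of_crossing h' h (by linarith) (by linarith)
    ⟨by linarith, by linarith⟩ ⟨by linarith, by linarith⟩)
  linarith

/-- There is a family of bends, one for every midpoint, which is continuous and invariant under the
deck transformations of the band. -/
theorem exists_bend_family : ∃ d : ℝ → ℝ, (∀ s t, |d s - d t| ≤ 2 * |s - t|) ∧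
    (∀ t, d (t + lam) = -d t) ∧ ∀ t, IsBend G (t - d t / 2) (t + d t / 2) := by
  have bdd : ∀ t, BddAbove (range fun s => sInf (bendSlopes G s) - 2 * |t - s|) := by
    intro t
    refine ⟨sSup (bendSlopes G t), ?_⟩
    rintro _ ⟨s, rfl⟩
    have := H.sInf_bendSlopes_le t s
    simp only
    linarith
  set D : ℝ → ℝ := fun t => ⨆ s, (sInf (bendSlopes G s) - 2 * |t - s|) with hD
  have hmem : ∀ t, D t ∈ bendSlopes G t := by
    intro t
    refine (H.ordConnected_bendSlopes t).out
      ((H.isCompact_bendSlopes t).sInf_mem (H.nonempty_bendSlopes t))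
      ((H.isCompact_bendSlopes t).sSup_mem (H.nonempty_bendSlopes t)) ⟨?_, ?_⟩
    · have := le_ciSup (bdd t) t
      simpa using this
    · refine ciSup_le fun s => ?_
      have := H.sInf_bendSlopes_le t s
      linarith
  have hlip : ∀ s t, D s ≤ D t + 2 * |s - t| := by
    intro s t
    refine ciSup_le fun r => ?_
    have h1 := le_ciSup (bdd t) r
    have h2 := abs_sub_le t s r
    rw [abs_sub_comm t s] at h2
    simp only [hD] at h1 ⊢
    linarith
  have hper : ∀ t, D (t + 2 * lam) = D t := by
    intro t
    simp only [hD]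
    rw [← (Equiv.addRight (2 * lam)).surjective.iSup_comp]
    refine iSup_congr fun s => ?_
    simp only [Equiv.coe_addRight]
    rw [H.bendSlopes_add_two_mul]
    ring_nf
  refine ⟨fun t => (D t - D (t + lam)) / 2, ?_, ?_, ?_⟩
  · intro s t
    have h1 := hlip s t
    have h2 := hlip t s
    have h3 := hlip (s + lam) (t + lam)
    have h4 := hlip (t + lam) (s + lam)
    rw [add_sub_add_right_eq_sub] at h3 h4
    rw [abs_sub_comm t s] at h2 h4
    rw [abs_le]
    constructor <;> linarith
  · intro t
    simp only
    rw [show t + lam + lam = t + 2 * lam by ring, hper]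
    ring
  · intro t
    have h1 := hmem t
    have h2 := H.mem_bendSlopes_add.1 (hmem (t + lam))
    rcases le_total (D t) (-D (t + lam)) with h | h
    · exact (H.ordConnected_bendSlopes t).out h1 h2 ⟨by linarith, by linarith⟩
    · exact (H.ordConnected_bendSlopes t).out h2 h1 ⟨by linarith, by linarith⟩

end IsPaperBand

/-! ### A zero of an antisymmetric function on a triangle -/

theorem eq_of_continuousOn_of_int {ψ : ℝ → ℝ} {a b : ℝ} (hab : a ≤ b)
    (hψ : ContinuousOn ψ (Icc a b)) (hint : ∀ x ∈ Icc a b, ∃ n : ℤ, ψ x = n) : ψ a = ψ b := by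
  obtain ⟨n, hn⟩ := hint a ⟨le_rfl, hab⟩
  obtain ⟨m, hm⟩ := hint b ⟨hab, le_rfl⟩
  have hoc : (ψ '' Icc a b).OrdConnected :=
    (isPreconnected_Icc.image ψ hψ).ordConnected
  have key : ∀ n m : ℤ, (n : ℝ) ∈ ψ '' Icc a b → (m : ℝ) ∈ ψ '' Icc a b → m ≤ n := by
    intro n m hn hm
    by_contra! hlt
    have h1 : (n : ℝ) + 1 ≤ m := by exact_mod_cast hlt
    obtain ⟨x, hx, hxe⟩ := hoc.out hn hm (show (n : ℝ) + 1 / 2 ∈ Icc (n : ℝ) m from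
      ⟨by linarith, by linarith⟩)
    obtain ⟨k, hk⟩ := hint x hx
    rw [hk] at hxe
    have h2 : n < k := by have : (n : ℝ) < k := by linarith
                          exact_mod_cast this
    have h3 : k < n + 1 := by have : (k : ℝ) < n + 1 := by linarith
                              exact_mod_cast this
    omega
  have ha : (n : ℝ) ∈ ψ '' Icc a b := ⟨a, ⟨le_rfl, hab⟩, hn⟩
  have hb : (m : ℝ) ∈ ψ '' Icc a b := ⟨b, ⟨hab, le_rfl⟩, hm⟩
  have := le_antisymm (key n m ha hb) (key m n hb ha)
  rw [hn, hm, this]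

/-- A continuous function on a strip which is positive on one boundary line, and antisymmetric under
the glide reflection of the strip, has a zero. -/
theorem exists_zero_of_antisymmetric {lam : ℝ} (hlam : 0 < lam) {w : ℝ × ℝ → ℂ}
    (hw : Continuous w) (hdiag : ∀ x, ∃ r : ℝ, 0 < r ∧ w (x, x) = r)
    (hanti : ∀ x y, w (y, x + lam) = -w (x, y)) :
    ∃ x y, 0 ≤ x ∧ x ≤ y ∧ y ≤ lam ∧ w (x, y) = 0 := by
  by_contra! hne
  set g : ℝ × ℝ → ℂ := fun p => w (max 0 (min p.1 (max 0 (min p.2 lam))), max 0 (min p.2 lam))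
    with hg
  have hgc : Continuous g := by fun_prop
  have hg0 : ∀ p, g p ≠ 0 := by
    intro p
    refine hne _ _ (le_max_left _ _) ?_ ?_
    · exact max_le (le_max_left _ _) (min_le_right _ _)
    · exact max_le hlam.le (min_le_right _ _)
  have hsc : IsSimplyConnected (univ : Set (ℝ × ℝ)) := by
    have := (convex_univ (𝕜 := ℝ) (E := ℝ × ℝ)).contractibleSpace univ_nonempty
    exact SimplyConnectedSpace.ofContractible _
  obtain ⟨θ, hθc, hθ⟩ := Complex.exists_continuousOn_eqOn_exp_comp hsc isOpen_univ
    hgc.continuousOn (by rintro ⟨p, -, hp⟩; exact hg0 p hp)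
  rw [continuousOn_univ] at hθc
  have hexp : ∀ x y, 0 ≤ x → x ≤ y → y ≤ lam → Complex.exp (θ (x, y)) = w (x, y) := by
    intro x y h1 h2 h3
    have := hθ (mem_univ (x, y))
    simp only [Function.comp_apply, hg] at this
    rw [this, min_eq_left h3, max_eq_right (h1.trans h2), min_eq_left h2, max_eq_right h1]
  have hpi := Real.pi_pos
  have hd : (θ (0, 0)).im / (2 * Real.pi) = (θ (lam, lam)).im / (2 * Real.pi) := by
    refine eq_of_continuousOn_of_int (ψ := fun t => (θ (t, t)).im / (2 * Real.pi)) hlam.le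
      (by fun_prop) ?_
    intro t ht
    obtain ⟨r, hr, hwr⟩ := hdiag t
    have h1 := hexp t t ht.1 le_rfl ht.2
    rw [hwr, show (r : ℂ) = Complex.exp (Real.log r) by
      rw [← Complex.ofReal_exp, Real.exp_log hr], Complex.exp_eq_exp_iff_exists_int] at h1
    obtain ⟨n, hn⟩ := h1
    refine ⟨n, ?_⟩
    simp only [hn]
    simp
  have hφ : ∀ t ∈ Icc 0 lam, ∃ n : ℤ,
      ((θ (t, lam) - θ (0, t)).im / Real.pi - 1) / 2 = n := by
    intro t ht
    have h1 := hexp t lam ht.1 ht.2 le_rfl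
    have h2 := hexp 0 t le_rfl ht.1 ht.2
    have h3 := hanti 0 t
    rw [zero_add] at h3
    have h4 : Complex.exp (θ (t, lam) - θ (0, t)) = Complex.exp (Real.pi * Complex.I) := by
      rw [Complex.exp_sub, h1, h3, ← h2, Complex.exp_pi_mul_I, neg_div,
        div_self (Complex.exp_ne_zero _)]
    rw [Complex.exp_eq_exp_iff_exists_int] at h4
    obtain ⟨n, hn⟩ := h4
    refine ⟨n, ?_⟩
    rw [hn]
    simp
    field_simp
    ring
  have hc := eq_of_continuousOn_of_int
    (ψ := fun t => ((θ (t, lam) - θ (0, t)).im / Real.pi - 1) / 2) hlam.le (by fun_prop) hφ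
  obtain ⟨n, hn⟩ := hφ 0 ⟨le_rfl, hlam.le⟩
  simp only [Complex.sub_im] at hc hn
  field_simp at hd hc hn
  have h0 : (θ (0, lam)).im - (θ (0, 0)).im = 0 := by linarith
  rw [h0] at hn
  have h5 : Real.pi * (2 * n + 1) = 0 := by linarith
  rcases mul_eq_zero.1 h5 with h | h
  · exact hpi.ne' h
  · have : 2 * n + 1 = 0 := by exact_mod_cast h
    omega

/-! ### Coplanar perpendicular bends -/

/-- The determinant of three vectors in space. -/
def tripleProduct (u v w : E3) : ℝ :=
  u 0 * (v 1 * w 2 - v 2 * w 1) - u 1 * (v 0 * w 2 - v 2 * w 0) + u 2 * (v 0 * w 1 - v 1 * w 0)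

theorem tripleProduct_sq {u v w : E3} (huv : ⟪u, v⟫ = 0) (huw : ⟪u, w⟫ = 0) (hvw : ⟪v, w⟫ = 0) :
    tripleProduct u v w ^ 2 = ‖u‖ ^ 2 * ‖v‖ ^ 2 * ‖w‖ ^ 2 := by
  have gram : tripleProduct u v w ^ 2 = ⟪u, u⟫ * ⟪v, v⟫ * ⟪w, w⟫ + 2 * ⟪u, v⟫ * ⟪v, w⟫ * ⟪u, w⟫
      - ⟪u, u⟫ * ⟪v, w⟫ ^ 2 - ⟪v, v⟫ * ⟪u, w⟫ ^ 2 - ⟪w, w⟫ * ⟪u, v⟫ ^ 2 := by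
    simp only [tripleProduct, PiLp.inner_apply, Fin.sum_univ_three, RCLike.inner_apply, conj_trivial]
    ring
  rw [gram, huv, huw, hvw, real_inner_self_eq_norm_sq, real_inner_self_eq_norm_sq,
    real_inner_self_eq_norm_sq]
  ring

theorem exists_intersection {P P' V V' : E3} (hV : V ≠ 0) (hV' : V' ≠ 0) (hVV : ⟪V, V'⟫ = 0)
    (hdet : tripleProduct (P' - P) V V' = 0) : ∃ s r : ℝ, P' + r • V' = P + s • V := by
  have hn : ‖V‖ ^ 2 ≠ 0 := pow_ne_zero _ (norm_ne_zero_iff.2 hV)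
  have hn' : ‖V'‖ ^ 2 ≠ 0 := pow_ne_zero _ (norm_ne_zero_iff.2 hV')
  obtain ⟨s, hs⟩ : ∃ s, s = ⟪P' - P, V⟫ / ‖V‖ ^ 2 := ⟨_, rfl⟩
  obtain ⟨r, hr⟩ : ∃ r, r = -⟪P' - P, V'⟫ / ‖V'‖ ^ 2 := ⟨_, rfl⟩
  refine ⟨s, r, ?_⟩
  have hVV' : ⟪V', V⟫ = 0 := by rw [real_inner_comm]; exact hVV
  have h1 : ⟪P' - P - s • V + r • V', V⟫ = 0 := by
    rw [inner_add_left, inner_sub_left, inner_smul_left, inner_smul_left, hVV',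
      real_inner_self_eq_norm_sq, hs]
    simp only [conj_trivial]
    field_simp
    ring
  have h2 : ⟪P' - P - s • V + r • V', V'⟫ = 0 := by
    rw [inner_add_left, inner_sub_left, inner_smul_left, inner_smul_left, hVV,
      real_inner_self_eq_norm_sq, hr]
    simp only [conj_trivial]
    field_simp
    ring
  have h3 : tripleProduct (P' - P - s • V + r • V') V V' = 0 := by
    rw [← hdet]
    simp [tripleProduct]
    ring
  have h4 := tripleProduct_sq h1 h2 hVV
  rw [h3] at h4
  have h5 : ‖P' - P - s • V + r • V'‖ ^ 2 = 0 := by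
    have h6 : ‖P' - P - s • V + r • V'‖ ^ 2 * (‖V‖ ^ 2 * ‖V'‖ ^ 2) = 0 := by linarith
    exact (mul_eq_zero.1 h6).resolve_right (mul_ne_zero hn hn')
  have h7 := norm_eq_zero.1 (pow_eq_zero_iff (two_ne_zero) |>.1 h5)
  rw [← sub_eq_zero, ← h7]
  abel

/-- A continuous monotone family of bends of a paper band, parametrised by their midpoints and
invariant under the deck transformations. -/
structure IsBendFamily (lam : ℝ) (G : ℝ × ℝ → E3) (a b : ℝ → ℝ) : Prop where
  continuous_left : Continuous a
  continuous_right : Continuous b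
  monotone_left : Monotone a
  monotone_right : Monotone b
  add_eq : ∀ t, a t + b t = 2 * t
  left_add : ∀ t, a (t + lam) = b t + lam
  right_add : ∀ t, b (t + lam) = a t + lam
  isBend : ∀ t, IsBend G (a t) (b t)

namespace IsPaperBand

variable {lam : ℝ} {G : ℝ × ℝ → E3} (H : IsPaperBand lam G)
include H

theorem exists_isBendFamily : ∃ a b, IsBendFamily lam G a b := by
  obtain ⟨d, hd, hanti, hbend⟩ := H.exists_bend_family
  have hcont : Continuous d :=
    (LipschitzWith.of_dist_le_mul (K := 2) fun s t => by simpa [Real.dist_eq] using hd s t).continuous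
  refine ⟨fun t => t - d t / 2, fun t => t + d t / 2, by fun_prop, by fun_prop, ?_, ?_, ?_, ?_, ?_,
    hbend⟩
  · intro s t hst
    have h1 := (abs_le.1 (hd s t)).1
    rw [abs_of_nonpos (sub_nonpos.2 hst)] at h1
    simp only; linarith
  · intro s t hst
    have h1 := (abs_le.1 (hd s t)).2
    rw [abs_of_nonpos (sub_nonpos.2 hst)] at h1
    simp only; linarith
  · intro t; ring
  · intro t; rw [hanti]; ring
  · intro t; rw [hanti]; ring

omit H in
theorem _root_.IsBendFamily.strictMono {a b : ℝ → ℝ} (F : IsBendFamily lam G a b) {y : ℝ}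
    (hy : y ∈ Ioo (0 : ℝ) 1) : StrictMono fun t => (1 - y) * a t + y * b t := by
  intro s t hst
  have h1 := F.monotone_left hst.le
  have h2 := F.monotone_right hst.le
  have h3 := F.add_eq s
  have h4 := F.add_eq t
  have h5 := hy.1
  have h6 := hy.2
  simp only
  rcases h1.lt_or_eq with h | h
  · nlinarith [mul_pos (sub_pos.2 h6) (sub_pos.2 h), mul_nonneg h5.le (sub_nonneg.2 h2)]
  · have : b s < b t := by linarith
    rw [h]; nlinarith [mul_pos h5 (sub_pos.2 this)]

/-- The bends of a family cover the band. -/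
theorem exists_isBend_through (x : ℝ) {y : ℝ} (hy : y ∈ Icc (0 : ℝ) 1) :
    ∃ a b, IsBend G a b ∧ (1 - y) * a + y * b = x := by
  obtain ⟨a, b, F⟩ := H.exists_isBendFamily
  have hp := H.pos
  have hclose : ∀ t, |((1 - y) * a t + y * b t) - t| ≤ lam := by
    intro t
    have h1 := (H.one_add_sq_le (F.isBend t)).2
    have h2 := F.add_eq t
    have h3 : ((1 - y) * a t + y * b t) - t = (y - 1 / 2) * (b t - a t) := by linarith
    rw [h3, abs_mul]
    have h4 : |y - 1 / 2| ≤ 1 := by rw [abs_le]; constructor <;> linarith [hy.1, hy.2]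
    nlinarith [abs_nonneg (y - 1 / 2), abs_nonneg (b t - a t)]
  have hcont : Continuous fun t => (1 - y) * a t + y * b t :=
    (F.continuous_left.const_mul _).add (F.continuous_right.const_mul _)
  have hivt := intermediate_value_Icc (a := x - lam) (b := x + lam) (by linarith) hcont.continuousOn
  obtain ⟨t, -, ht⟩ := hivt (show x ∈ Icc _ _ from
    ⟨by linarith [(abs_le.1 (hclose (x - lam))).2], by linarith [(abs_le.1 (hclose (x + lam))).1]⟩)
  exact ⟨a t, b t, F.isBend t, ht⟩

theorem deck_translate {a b : ℝ → ℝ} (F : IsBendFamily lam G a b) (k : ℤ) {t x y : ℝ}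
    (hy : y ∈ Ioo (0 : ℝ) 1) (hx : x = (1 - y) * a t + y * b t) :
    ∃ y' ∈ Ioo (0 : ℝ) 1, G (x + k * lam, y') = G (x, y) ∧
      x + k * lam = (1 - y') * a (t + k * lam) + y' * b (t + k * lam) := by
  induction k with
  | zero => exact ⟨y, hy, by simp, by simpa using hx⟩
  | succ n ih =>
    obtain ⟨y', hy', hG, hx'⟩ := ih
    refine ⟨1 - y', ⟨by linarith [hy'.2], by linarith [hy'.1]⟩, ?_, ?_⟩
    · rw [← hG, ← H.glue _ y' ⟨hy'.1.le, hy'.2.le⟩]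
      congr 2; push_cast; ring
    · have e : t + ((n + 1 : ℤ) : ℝ) * lam = (t + (n : ℤ) * lam) + lam := by push_cast; ring
      rw [e, F.left_add, F.right_add]
      push_cast at hx' ⊢
      linarith
  | pred n ih =>
    obtain ⟨y', hy', hG, hx'⟩ := ih
    refine ⟨1 - y', ⟨by linarith [hy'.2], by linarith [hy'.1]⟩, ?_, ?_⟩
    · rw [← hG, ← H.glue _ (1 - y') ⟨by linarith [hy'.2], by linarith [hy'.1]⟩]
      congr 2
      · push_cast; ring
      · ring
    · have e : t + ((-n : ℤ) : ℝ) * lam = (t + ((-n - 1 : ℤ) : ℝ) * lam) + lam := by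
        push_cast; ring
      rw [e, F.left_add, F.right_add] at hx'
      push_cast at hx' ⊢
      linarith

theorem eq_add_mul_of_apply_eq {a b : ℝ → ℝ} (F : IsBendFamily lam G a b) {t t' x x' y y' : ℝ}
    (hy : y ∈ Ioo (0 : ℝ) 1) (hx : x = (1 - y) * a t + y * b t)
    (hy' : y' ∈ Ioo (0 : ℝ) 1) (hx' : x' = (1 - y') * a t' + y' * b t')
    (h : G (x, y) = G (x', y')) : ∃ k : ℤ, t' = t + k * lam := by
  have hp := H.pos
  have hfloor : ∀ x : ℝ, x + ((-⌊x / lam⌋ : ℤ) : ℝ) * lam ∈ Ico 0 lam := by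
    intro x
    have h1 := Int.floor_le (x / lam)
    have h2 := Int.lt_floor_add_one (x / lam)
    rw [le_div_iff₀ hp] at h1
    rw [div_lt_iff₀ hp] at h2
    push_cast
    constructor <;> linarith
  obtain ⟨z, hz, hGz, hxz⟩ := H.deck_translate F (-⌊x / lam⌋) hy hx
  obtain ⟨z', hz', hGz', hxz'⟩ := H.deck_translate F (-⌊x' / lam⌋) hy' hx'
  obtain ⟨e1, e2⟩ := H.inj _ _ z z' (hfloor x) (hfloor x') ⟨hz.1.le, hz.2.le⟩ ⟨hz'.1.le, hz'.2.le⟩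
    (by rw [hGz, hGz', h])
  subst e2
  rw [hxz, hxz'] at e1
  have := (F.strictMono hz).injective e1
  refine ⟨-⌊x / lam⌋ - -⌊x' / lam⌋, ?_⟩
  push_cast at this ⊢
  linarith

theorem exists_perpendicular_bends : ∃ a b a' b' s r : ℝ, IsBend G a b ∧ IsBend G a' b' ∧
    a ≤ a' ∧ a' ≤ b + lam ∧ b ≤ b' ∧ b' ≤ a + lam ∧
    ⟪G (b, 1) - G (a, 0), G (b', 1) - G (a', 0)⟫ = 0 ∧
    G (a', 0) + r • (G (b', 1) - G (a', 0)) = G (a, 0) + s • (G (b, 1) - G (a, 0)) ∧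
    r ∉ Ioo (0 : ℝ) 1 := by
  obtain ⟨a, b, F⟩ := H.exists_isBendFamily
  have hp := H.pos
  have ca := F.continuous_left
  have cb := F.continuous_right
  have cG := H.smooth.continuous
  set P : ℝ → E3 := fun t => G (a t, 0) with hP
  set V : ℝ → E3 := fun t => G (b t, 1) - G (a t, 0) with hV
  have cP : Continuous P := by fun_prop
  have cV : Continuous V := by fun_prop
  have hVadd : ∀ t, V (t + lam) = -V t := by
    intro t
    simp only [hV]
    rw [F.left_add, F.right_add, H.glue_zero, H.glue_one, neg_sub]
  have hPadd : ∀ t, P (t + lam) = P t + V t := by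
    intro t
    simp only [hP, hV]
    rw [F.left_add, H.glue_one]
    abel
  have hV0 : ∀ t, V t ≠ 0 := by
    intro t ht
    have : ‖V t‖ = √((b t - a t) ^ 2 + 1) := F.isBend t
    rw [ht, norm_zero] at this
    have := Real.sqrt_pos.2 (show 0 < (b t - a t) ^ 2 + 1 by positivity)
    linarith
  have hVpos : ∀ t, 0 < ⟪V t, V t⟫ := fun t => real_inner_self_pos.2 (hV0 t)
  have cc : ∀ i, Continuous fun t => V t i := fun i => by fun_prop
  have cd : ∀ i, Continuous fun t => P t i := fun i => by fun_prop
  obtain ⟨t, t', ht0, htt, ht', hw⟩ := exists_zero_of_antisymmetric hp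
    (w := fun p => (⟪V p.1, V p.2⟫ : ℂ) +
      (tripleProduct (P p.2 - P p.1) (V p.1) (V p.2) : ℂ) * Complex.I)
    (by unfold tripleProduct; simp only [PiLp.sub_apply]; fun_prop)
    (fun x => ⟨⟪V x, V x⟫, hVpos x, by simp [tripleProduct]⟩)
    (by
      intro x y
      simp only
      rw [hVadd, hPadd, inner_neg_right, real_inner_comm]
      have : tripleProduct (P x + V x - P y) (V y) (-V x) =
          -tripleProduct (P y - P x) (V x) (V y) := by
        simp [tripleProduct]; ring
      rw [this]
      push_cast
      ring)
  have hre := congrArg Complex.re hw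
  have him := congrArg Complex.im hw
  simp at hre him
  have hlt : t < t' := by
    rcases htt.lt_or_eq with h | h
    · exact h
    · rw [h] at hre; exact absurd hre (hVpos t').ne'
  have hlt' : t' < t + lam := by
    by_contra! h
    have h1 : t' = 0 + lam := by linarith
    have h2 : t = 0 := by linarith
    rw [h1, h2, hVadd, inner_neg_right] at hre
    linarith [hVpos 0]
  obtain ⟨s, r, hsr⟩ := exists_intersection (hV0 t) (hV0 t') hre him
  have m1 := F.monotone_left hlt.le
  have m2 := F.monotone_right hlt.le
  have m3 := F.monotone_left hlt'.le
  have m4 := F.monotone_right hlt'.le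
  rw [F.left_add] at m3
  rw [F.right_add] at m4
  by_cases hr : r ∈ Ioo (0 : ℝ) 1
  · by_cases hs : s ∈ Ioo (0 : ℝ) 1
    · exfalso
      have e1 := H.bend_apply (F.isBend t) ⟨hs.1.le, hs.2.le⟩
      have e2 := H.bend_apply (F.isBend t') ⟨hr.1.le, hr.2.le⟩
      obtain ⟨k, hk⟩ := H.eq_add_mul_of_apply_eq F hs rfl hr rfl (by rw [e1, e2]; exact hsr.symm)
      have k0 : (0 : ℝ) < k := by
        by_contra! h
        nlinarith
      have k1 : (k : ℝ) < 1 := by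
        by_contra! h
        nlinarith
      have k2 : 0 < k := by exact_mod_cast k0
      have k3 : k < 1 := by exact_mod_cast k1
      omega
    · refine ⟨a t', b t', b t + lam, a t + lam, r, 1 - s, F.isBend t', H.isBend_add.2 (F.isBend t),
        m3, by linarith, m4, by linarith, ?_, ?_, ?_⟩
      · rw [H.glue_zero, H.glue_one, real_inner_comm]
        have : G (a t, 0) - G (b t, 1) = -V t := by simp [hV]
        rw [this, inner_neg_left, neg_eq_zero]
        exact hre
      · rw [H.glue_zero, H.glue_one]
        refine Eq.trans ?_ hsr.symm
        simp only [hP, hV]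
        module
      · intro h
        exact hs ⟨by linarith [h.2], by linarith [h.1]⟩
  · exact ⟨a t, b t, a t', b t', s, r, F.isBend t, F.isBend t', m1, m3, m2, m4, hre, hsr, hr⟩

end IsPaperBand

/-! ### Distance to an equilateral triangle -/

theorem sqrt_three_bounds : (1732 : ℝ) / 1000 < √3 ∧ √3 < 17321 / 10000 := by
  constructor
  · rw [Real.lt_sqrt (by norm_num)]; norm_num
  · rw [Real.sqrt_lt' (by norm_num)]; norm_num

/-- The point at distance `ξ` along the major axis and at height `h` above it has focal distances
`m` and `n`; the semi-axes of its ellipse are compared with `ξ` and `h`. -/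
theorem ellipse_estimates {c ξ h m n : ℝ} (hc0 : 0 < c) (hm0 : 0 ≤ m) (hn0 : 0 ≤ n) (hh : 1 ≤ h)
    (hm : m ^ 2 = (c / 2 + ξ) ^ 2 + h ^ 2) (hn : n ^ 2 = (c / 2 - ξ) ^ 2 + h ^ 2) :
    4 * h ^ 2 ≤ (m + n) ^ 2 - c ^ 2 ∧
      4 * ξ ^ 2 * ((m + n) ^ 2 - c ^ 2) = ((m + n) ^ 2 - c ^ 2 - 4 * h ^ 2) * (m + n) ^ 2 := by
  obtain ⟨N, hN⟩ : ∃ N, N = m + n := ⟨_, rfl⟩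
  have h1 : c / 2 + ξ < m := by
    refine lt_of_le_of_lt (le_abs_self _) (abs_lt_of_sq_lt_sq ?_ hm0)
    rw [hm]; linarith [show 0 < h ^ 2 by positivity]
  have h2 : c / 2 - ξ < n := by
    refine lt_of_le_of_lt (le_abs_self _) (abs_lt_of_sq_lt_sq ?_ hn0)
    rw [hn]; linarith [show 0 < h ^ 2 by positivity]
  have hNc : c < N := by linarith
  have hdiff : (m - n) * N = 2 * c * ξ := by rw [hN]; linarith
  have hsum : N ^ 2 + (m - n) ^ 2 = c ^ 2 + 4 * ξ ^ 2 + 4 * h ^ 2 := by rw [hN]; linarith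
  have hell : (N ^ 2 - c ^ 2) * N ^ 2 = 4 * h ^ 2 * N ^ 2 + 4 * ξ ^ 2 * (N ^ 2 - c ^ 2) := by
    have : ((m - n) * N) ^ 2 = (2 * c * ξ) ^ 2 := by rw [hdiff]
    linear_combination N ^ 2 * hsum - this
  have hD0 : 0 ≤ N ^ 2 - c ^ 2 := sub_nonneg.2 (pow_le_pow_left₀ hc0.le hNc.le 2)
  have hNpos : 0 < N ^ 2 := pow_pos (hc0.trans hNc) 2
  rw [← hN]
  refine ⟨?_, by linarith⟩
  have : 4 * h ^ 2 * N ^ 2 ≤ (N ^ 2 - c ^ 2) * N ^ 2 := by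
    rw [hell]; linarith [mul_nonneg (mul_nonneg (by norm_num : (0 : ℝ) ≤ 4) (sq_nonneg ξ)) hD0]
  exact le_of_mul_le_mul_right this hNpos

theorem tangent_estimates {k u c N : ℝ} (hk : k ^ 2 = 3) (hc0 : 0 ≤ c) (hN0 : 0 ≤ N)
    (hc : 1 + u ^ 2 ≤ c ^ 2) (hN : 5 + u ^ 2 ≤ N ^ 2) :
    k / 2 + u / 2 ≤ c ∧ 5 * k / 4 + u / 4 ≤ N := by
  constructor
  · refine le_trans (le_abs_self _) (abs_le_of_sq_le_sq ?_ hc0)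
    nlinarith [sq_nonneg (u * k - 1)]
  · refine le_trans (le_abs_self _) (abs_le_of_sq_le_sq ?_ hN0)
    nlinarith [sq_nonneg (u * k - 1)]

theorem slope_estimates {ε lam u c N : ℝ} (hε0 : 0 < ε) (hε : ε < 1 / 4)
    (hlam : lam < √3 + ε) (hc0 : 0 < c) (hN0 : 0 ≤ N) (hc : c ^ 2 = 1 + u ^ 2)
    (hD : 4 ≤ N ^ 2 - c ^ 2) (hNL : N ≤ lam + u) (hcr : c ≤ lam - u) :
    lam + u ≤ 11 / 4 ∧ lam - u ≤ 7 / 4 ∧ lam + u - N ≤ 3 / 2 * ε ∧ lam - u - c ≤ 3 * ε ∧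
      |c / 2 - √3 / 3| ≤ 2 * ε ∧ N ^ 2 - c ^ 2 ≤ 4 + 8 * ε := by
  have hs3 : √3 ^ 2 = 3 := Real.sq_sqrt (by norm_num)
  obtain ⟨hk2, hk1⟩ := sqrt_three_bounds
  obtain ⟨hct, hNt⟩ := tangent_estimates hs3 hc0.le hN0 hc.ge (by linarith)
  obtain ⟨k, hk⟩ : ∃ k, √3 = k := ⟨_, rfl⟩
  rw [hk] at hlam hs3 hk1 hk2 hct hNt ⊢
  have hu1 : k / 3 - 4 * ε / 3 ≤ u := by linarith
  have hu2 : u ≤ k / 3 + 2 * ε / 3 := by linarith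
  have hu0 : 0 ≤ u := by linarith
  have hlam0 : 0 ≤ lam := by linarith
  refine ⟨by linarith, by linarith, by linarith, by linarith, ?_, ?_⟩
  · rw [abs_le]; constructor <;> linarith
  · have h1 : N ^ 2 ≤ (lam + u) ^ 2 := pow_le_pow_left₀ hN0 hNL 2
    have h4 : lam ^ 2 ≤ (k + ε) ^ 2 := pow_le_pow_left₀ hlam0 hlam.le 2
    have h5 : lam * u ≤ (k + ε) * (k / 3 + 2 * ε / 3) :=
      mul_le_mul hlam.le hu2 hu0 (by linarith)
    have h6 : k * ε ≤ 17321 / 10000 * ε := mul_le_mul_of_nonneg_right hk1.le hε0.le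
    have h7 : ε * ε ≤ 1 / 4 * ε := mul_le_mul_of_nonneg_right hε.le hε0.le
    linarith

theorem short_band_estimates {ε lam u c ξ h m n p q : ℝ} (hε0 : 0 < ε) (hε : ε < 1 / 4)
    (hlam : lam < √3 + ε) (hc0 : 0 < c) (hc : c ^ 2 = 1 + u ^ 2) (hh : 1 ≤ h) (hm0 : 0 ≤ m)
    (hn0 : 0 ≤ n) (hm : m ^ 2 = (c / 2 + ξ) ^ 2 + h ^ 2) (hn : n ^ 2 = (c / 2 - ξ) ^ 2 + h ^ 2)
    (hmp : m ≤ p) (hnq : n ≤ q) (hpq : p + q = lam + u) (hcr : c ≤ lam - u) :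
    p ^ 2 - m ^ 2 ≤ 16 * ε ∧ q ^ 2 - n ^ 2 ≤ 16 * ε ∧ (lam - u) ^ 2 - c ^ 2 ≤ 16 * ε ∧
      |c / 2 - √3 / 3| ≤ 2 * ε ∧ ξ ^ 2 + (h - 1) ^ 2 ≤ 16 * ε := by
  obtain ⟨hD, hξ⟩ := ellipse_estimates hc0 hm0 hn0 hh hm hn
  have hh2 : 1 ≤ h ^ 2 := one_le_pow₀ hh
  have hNL : m + n ≤ lam + u := by linarith
  have hN0 : 0 ≤ m + n := by linarith
  obtain ⟨h1, h2, h3, h4, h5, h6⟩ := slope_estimates hε0 hε hlam hc0 hN0 hc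
    (by linarith) hNL hcr
  have prod : ∀ x y z : ℝ, 0 ≤ x + y → x + y ≤ z → z ≤ 11 / 2 → x - y ≤ 3 / 2 * ε →
      x ^ 2 - y ^ 2 ≤ 16 * ε := by
    intro x y z hxy hz hz' hd
    have e1 : (x - y) * (x + y) ≤ (3 / 2 * ε) * (x + y) := mul_le_mul_of_nonneg_right hd hxy
    have e2 : (3 / 2 * ε) * (x + y) ≤ (3 / 2 * ε) * (11 / 2) :=
      mul_le_mul_of_nonneg_left (by linarith) (by linarith)
    linarith
  refine ⟨prod p m (2 * (lam + u)) (by linarith) (by linarith) (by linarith) (by linarith),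
    prod q n (2 * (lam + u)) (by linarith) (by linarith) (by linarith) (by linarith), ?_, h5, ?_⟩
  · have e1 : (lam - u - c) * (lam - u + c) ≤ (3 * ε) * (lam - u + c) :=
      mul_le_mul_of_nonneg_right h4 (by linarith)
    have e2 : (3 * ε) * (lam - u + c) ≤ (3 * ε) * (7 / 2) :=
      mul_le_mul_of_nonneg_left (by linarith) (by linarith)
    linarith
  · have e1 : h - 1 ≤ 2 * ε := by nlinarith
    have e2 : (h - 1) ^ 2 ≤ (2 * ε) ^ 2 := pow_le_pow_left₀ (by linarith) e1 2
    have e3 : ε * ε ≤ 1 / 4 * ε := mul_le_mul_of_nonneg_right hε.le hε0.le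
    have e4 : (m + n) ^ 2 ≤ (11 / 4) ^ 2 := pow_le_pow_left₀ hN0 (by linarith) 2
    have e5 : ((m + n) ^ 2 - c ^ 2 - 4 * h ^ 2) * (m + n) ^ 2 ≤ (8 * ε) * (11 / 4) ^ 2 :=
      mul_le_mul (by linarith) e4 (sq_nonneg _) (by linarith)
    have e6 : 4 * ξ ^ 2 * 4 ≤ 4 * ξ ^ 2 * ((m + n) ^ 2 - c ^ 2) :=
      mul_le_mul_of_nonneg_left (by linarith) (by positivity)
    linarith

theorem exists_convex_combination_norm_sub_le {P Q z : E3} {L η : ℝ} (hη : 0 ≤ η)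
    (hL : ‖z - P‖ + ‖z - Q‖ ≤ L) (hc : L ^ 2 - ‖Q - P‖ ^ 2 ≤ 4 * η ^ 2) :
    ∃ t ∈ Icc (0 : ℝ) 1, ‖z - (P + t • (Q - P))‖ ≤ η := by
  obtain ⟨p, hp⟩ : ∃ p, p = ‖z - P‖ := ⟨_, rfl⟩
  obtain ⟨q, hq⟩ : ∃ q, q = ‖z - Q‖ := ⟨_, rfl⟩
  have hp0 : 0 ≤ p := hp ▸ norm_nonneg _
  have hq0 : 0 ≤ q := hq ▸ norm_nonneg _
  rw [← hp, ← hq] at hL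
  rcases (add_nonneg hp0 hq0).eq_or_lt with h0 | h0
  · refine ⟨0, by simp, ?_⟩
    rw [zero_smul, add_zero, ← hp]
    linarith
  have htI : p / (p + q) ∈ Icc (0 : ℝ) 1 :=
    ⟨div_nonneg hp0 h0.le, (div_le_one h0).2 (by linarith)⟩
  refine ⟨p / (p + q), htI, abs_le_of_sq_le_sq' ?_ hη |>.2⟩
  obtain ⟨t, ht⟩ : ∃ t, t = p / (p + q) := ⟨_, rfl⟩
  have hpt : p = t * (p + q) := by rw [ht, div_mul_cancel₀ _ h0.ne']
  have hqt : q = (1 - t) * (p + q) := by linarith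
  rw [norm_sub_convex_combination_sq, ← hp, ← hq, ← ht]
  rw [← ht] at htI
  have hS : (p + q) ^ 2 ≤ L ^ 2 := pow_le_pow_left₀ h0.le hL 2
  have e : (1 - t) * p ^ 2 + t * q ^ 2 = t * (1 - t) * (p + q) ^ 2 := by
    obtain ⟨S, hS⟩ : ∃ S, S = p + q := ⟨_, rfl⟩
    rw [← hS] at hpt hqt ⊢
    rw [hpt, hqt]; ring
  have h1 : t * (1 - t) * ((p + q) ^ 2 - ‖Q - P‖ ^ 2) ≤ t * (1 - t) * (4 * η ^ 2) :=
    mul_le_mul_of_nonneg_left (by linarith) (mul_nonneg htI.1 (sub_nonneg.2 htI.2))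
  have h2 : t * (1 - t) * (4 * η ^ 2) ≤ 1 / 4 * (4 * η ^ 2) :=
    mul_le_mul_of_nonneg_right (by linarith [sq_nonneg (t - 1 / 2)]) (by positivity)
  linarith

theorem infDist_le_of_norm_add_norm_le {T : Set E3} (hT : Convex ℝ T) {P Q P' Q' z : E3}
    {L η δ : ℝ} (hη : 0 ≤ η) (hL : ‖z - P‖ + ‖z - Q‖ ≤ L)
    (hc : L ^ 2 - ‖Q - P‖ ^ 2 ≤ 4 * η ^ 2) (hP' : P' ∈ T) (hQ' : Q' ∈ T)
    (hP : ‖P - P'‖ ≤ δ) (hQ : ‖Q - Q'‖ ≤ δ) : Metric.infDist z T ≤ η + δ := by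
  obtain ⟨t, ht, hz⟩ := exists_convex_combination_norm_sub_le hη hL hc
  refine (Metric.infDist_le_dist_of_mem (hT.add_smul_sub_mem hP' hQ' ht)).trans ?_
  have e : z - (P' + t • (Q' - P')) =
      (z - (P + t • (Q - P))) + ((1 - t) • (P - P') + t • (Q - Q')) := by module
  rw [dist_eq_norm, e]
  refine (norm_add_le _ _).trans (add_le_add hz ((norm_add_le _ _).trans ?_))
  rw [norm_smul, norm_smul, Real.norm_of_nonneg ht.1, Real.norm_of_nonneg (sub_nonneg.2 ht.2)]
  linarith [mul_le_mul_of_nonneg_left hP (sub_nonneg.2 ht.2), mul_le_mul_of_nonneg_left hQ ht.1]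

theorem convex_infDist_le {T : Set E3} (hT : Convex ℝ T) (hc : IsCompact T) (hne : T.Nonempty)
    (r : ℝ) : Convex ℝ {z | Metric.infDist z T ≤ r} := by
  intro x hx y hy a b ha hb hab
  obtain ⟨x', hx', ex⟩ := hc.exists_infDist_eq_dist hne x
  obtain ⟨y', hy', ey⟩ := hc.exists_infDist_eq_dist hne y
  refine (Metric.infDist_le_dist_of_mem (hT hx' hy' ha hb hab)).trans ?_
  refine (dist_add_add_le _ _ _ _).trans ?_
  rw [dist_smul₀, dist_smul₀, Real.norm_of_nonneg ha, Real.norm_of_nonneg hb, ← ex, ← ey]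
  have h1 := mul_le_mul_of_nonneg_left (mem_ofPred.1 hx) ha
  have h2 := mul_le_mul_of_nonneg_left (mem_ofPred.1 hy) hb
  have : a * r + b * r = r := by rw [← add_mul, hab, one_mul]
  linarith

theorem norm_smul_add_smul_sq {e e' : E3} (he : ‖e‖ = 1) (he' : ‖e'‖ = 1) (hee : ⟪e, e'⟫ = 0)
    (x y : ℝ) : ‖x • e + y • e'‖ ^ 2 = x ^ 2 + y ^ 2 := by
  rw [norm_add_sq_real, norm_smul, norm_smul, inner_smul_left, inner_smul_right, hee, he, he']
  simp

theorem norm_smul_add_smul_eq {e e' : E3} (he : ‖e‖ = 1) (he' : ‖e'‖ = 1) (hee : ⟪e, e'⟫ = 0)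
    (x y : ℝ) : ‖x • e + y • e'‖ = √(x ^ 2 + y ^ 2) := by
  rw [← norm_smul_add_smul_sq he he' hee, Real.sqrt_sq (norm_nonneg _)]

/-- An equilateral triangle of perimeter `2 * √3` with given base direction and height. -/
theorem dist_equilateral {e e' : E3} (he : ‖e‖ = 1) (he' : ‖e'‖ = 1) (hee : ⟪e, e'⟫ = 0) (M : E3) :
    dist (M - (√3 / 3) • e) (M + (√3 / 3) • e) = 2 * √3 / 3 ∧
      dist (M + (√3 / 3) • e) (M + e') = 2 * √3 / 3 ∧
      dist (M + e') (M - (√3 / 3) • e) = 2 * √3 / 3 := by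
  have N := norm_smul_add_smul_eq he he' hee
  have hs3 : √3 ^ 2 = 3 := Real.sq_sqrt (by norm_num)
  have hside : √(4 / 3) = 2 * √3 / 3 := by
    rw [Real.sqrt_eq_iff_mul_self_eq (by norm_num) (by positivity)]; linarith
  refine ⟨?_, ?_, ?_⟩ <;> rw [dist_eq_norm, ← hside]
  · rw [show M - (√3 / 3) • e - (M + (√3 / 3) • e) =
      (-(2 * √3 / 3)) • e + (0 : ℝ) • e' by module, N]
    congr 1; linarith
  · rw [show M + (√3 / 3) • e - (M + e') = (√3 / 3) • e + (-1 : ℝ) • e' by module, N]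
    congr 1; linarith
  · rw [show M + e' - (M - (√3 / 3) • e) = (√3 / 3) • e + (1 : ℝ) • e' by module, N]
    congr 1; linarith

/-- A closed curve of length at most `2 * (√3 + ε)` through the vertices of a triangle of height at
least one whose base cuts off a controlled length is close to an equilateral triangle. -/
theorem exists_triangle_of_closed_curve {ε lam u c τ h s₀ s₁ s₂ s₃ : ℝ} (hε0 : 0 < ε)
    (hε : ε < 1 / 4) (hlam : lam < √3 + ε) (hc0 : 0 < c) (hc : c ^ 2 = 1 + u ^ 2) (hh : 1 ≤ h)
    {β : ℝ → E3} (hβ : ∀ s t, ‖β s - β t‖ ≤ |s - t|) (h01 : s₀ ≤ s₁) (h12 : s₁ ≤ s₂)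
    (h23 : s₂ ≤ s₃) (hclosed : β s₃ = β s₀) (h02 : s₂ - s₀ = lam + u) (h32 : s₃ - s₂ = lam - u)
    {e e' : E3} (he : ‖e‖ = 1) (he' : ‖e'‖ = 1) (hee : ⟪e, e'⟫ = 0)
    (hY : β s₂ = β s₀ + c • e) (hZ : β s₁ = β s₀ + τ • e + h • e') :
    ∃ A B C : E3, dist A B = 2 * √3 / 3 ∧ dist B C = 2 * √3 / 3 ∧ dist C A = 2 * √3 / 3 ∧
      ∀ s ∈ Icc s₀ s₃, Metric.infDist (β s) (convexHull ℝ {A, B, C}) ≤ 6 * √ε := by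
  have N := norm_smul_add_smul_eq he he' hee
  have N2 := norm_smul_add_smul_sq he he' hee
  have hYX : ‖β s₂ - β s₀‖ = c := by
    rw [hY, add_sub_cancel_left, norm_smul, he, mul_one, Real.norm_of_nonneg hc0.le]
  have hm : ‖β s₁ - β s₀‖ ^ 2 = (c / 2 + (τ - c / 2)) ^ 2 + h ^ 2 := by
    rw [← N2, hZ]; congr 2; module
  have hn : ‖β s₂ - β s₁‖ ^ 2 = (c / 2 - (τ - c / 2)) ^ 2 + h ^ 2 := by
    rw [← neg_sq h, ← N2, hZ, hY]; congr 2; module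
  have hmp := hβ s₁ s₀
  have hnq := hβ s₂ s₁
  have hcr := hβ s₃ s₂
  rw [hclosed, norm_sub_rev, hYX, abs_of_nonneg (by linarith), h32] at hcr
  rw [abs_of_nonneg (by linarith)] at hmp hnq
  obtain ⟨a1, a2, a3, a4, a5⟩ := short_band_estimates hε0 hε hlam hc0 hc hh (norm_nonneg _)
    (norm_nonneg _) hm hn hmp hnq (by linarith) hcr
  have hsε : √ε ^ 2 = ε := Real.sq_sqrt hε0.le
  have hsε0 : 0 ≤ √ε := Real.sqrt_nonneg ε
  have hsε1 : √ε ≤ 1 / 2 := Real.sqrt_le_iff.2 ⟨by norm_num, by linarith⟩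
  have hδ : 2 * ε ≤ 4 * √ε := by
    have := mul_le_mul_of_nonneg_right hsε1 hsε0
    rw [← sq, hsε] at this
    linarith only [this, hsε0]
  set M : E3 := β s₀ + (c / 2) • e with hM
  set A : E3 := M - (√3 / 3) • e with hA
  set B : E3 := M + (√3 / 3) • e with hB
  set C : E3 := M + e' with hC
  have hT : Convex ℝ (convexHull ℝ {A, B, C}) := convex_convexHull ℝ _
  have hAT : A ∈ convexHull ℝ {A, B, C} := subset_convexHull ℝ _ (by simp)
  have hBT : B ∈ convexHull ℝ {A, B, C} := subset_convexHull ℝ _ (by simp)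
  have hCT : C ∈ convexHull ℝ {A, B, C} := subset_convexHull ℝ _ (by simp)
  have hXA : ‖β s₀ - A‖ ≤ 4 * √ε := by
    have : β s₀ - A = -((c / 2 - √3 / 3) • e) := by rw [hA, hM]; module
    rw [this, norm_neg, norm_smul, he, mul_one]
    exact a4.trans hδ
  have hYB : ‖β s₂ - B‖ ≤ 4 * √ε := by
    have : β s₂ - B = (c / 2 - √3 / 3) • e := by rw [hB, hM, hY]; module
    rw [this, norm_smul, he, mul_one]
    exact a4.trans hδ
  have hZC : ‖β s₁ - C‖ ≤ 4 * √ε := by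
    have : β s₁ - C = (τ - c / 2) • e + (h - 1) • e' := by rw [hC, hM, hZ]; module
    rw [this, N]
    exact Real.sqrt_le_iff.2 ⟨by positivity, by rw [mul_pow, hsε]; linarith only [a5]⟩
  have arc : ∀ a b s L : ℝ, s ∈ Icc a b → b - a = L → ‖β s - β a‖ + ‖β s - β b‖ ≤ L := by
    intro a b s L hs hL
    have h1 := hβ s a
    have h2 := hβ s b
    rw [abs_of_nonneg (by linarith [hs.1])] at h1
    rw [abs_of_nonpos (by linarith [hs.2])] at h2
    linarith
  have hη : 4 * (2 * √ε) ^ 2 = 16 * ε := by rw [mul_pow, hsε]; ring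
  have hsum : 2 * √ε + 4 * √ε = 6 * √ε := by ring
  obtain ⟨d1, d2, d3⟩ := dist_equilateral he he' hee M
  refine ⟨A, B, C, d1, d2, d3, ?_⟩
  intro s hs
  rw [← hsum]
  rcases le_total s s₁ with h | h
  · exact infDist_le_of_norm_add_norm_le hT (by positivity) (arc s₀ s₁ s _ ⟨hs.1, h⟩ rfl)
      (by rw [hη]; exact a1) hAT hCT hXA hZC
  rcases le_total s s₂ with h' | h'
  · exact infDist_le_of_norm_add_norm_le hT (by positivity) (arc s₁ s₂ s _ ⟨h, h'⟩ rfl)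
      (by rw [hη]; exact a2) hCT hBT hZC hYB
  · refine infDist_le_of_norm_add_norm_le hT (by positivity) (arc s₂ s₃ s _ ⟨h', hs.2⟩ rfl)
      (by rw [hη, hclosed, norm_sub_rev, hYX, h32]; exact a3) hBT hAT hYB (by rwa [hclosed])

namespace IsPaperBand

variable {lam : ℝ} {G : ℝ × ℝ → E3} (H : IsPaperBand lam G)
include H

theorem norm_boundary_sub_le (s t : ℝ) : ‖G (s, 0) - G (t, 0)‖ ≤ |s - t| := by
  have := H.norm_sub_le (p := (t, 0)) (q := (s, 0)) (by simp) (by simp)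
  simpa [Real.sqrt_sq_eq_abs] using this

theorem exists_triangle {ε : ℝ} (hε0 : 0 < ε) (hε : ε < 1 / 4) (hlam : lam < √3 + ε) :
    ∃ A B C : E3, dist A B = 2 * √3 / 3 ∧ dist B C = 2 * √3 / 3 ∧ dist C A = 2 * √3 / 3 ∧
      ∃ s₀, ∀ s ∈ Icc s₀ (s₀ + 2 * lam),
        Metric.infDist (G (s, 0)) (convexHull ℝ {A, B, C}) ≤ 6 * √ε := by
  obtain ⟨a, b, a', b', s, r, hab, hab', haa, hab1, hbb, hba, hperp, hmeet, hr⟩ :=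
    H.exists_perpendicular_bends
  have sub_lam : ∀ x, G (x - lam, 0) = G (x, 1) := by
    intro x
    have := H.glue_zero (x - lam)
    rwa [sub_add_cancel, eq_comm] at this
  obtain ⟨V, hV⟩ : ∃ V, V = G (b, 1) - G (a, 0) := ⟨_, rfl⟩
  obtain ⟨V', hV'⟩ : ∃ V', V' = G (b', 1) - G (a', 0) := ⟨_, rfl⟩
  have hlt := (H.one_add_sq_le hab).2
  unfold IsBend at hab hab'
  rw [← hV] at hab
  rw [← hV'] at hab'
  rw [← hV, ← hV'] at hperp hmeet
  have hc2 : ‖V‖ ^ 2 = (b - a) ^ 2 + 1 := by rw [hab, Real.sq_sqrt (by positivity)]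
  have one_le : ∀ x : ℝ, 1 ≤ √(x ^ 2 + 1) := fun x =>
    Real.one_le_sqrt.2 (by linarith [sq_nonneg x])
  have hV0 : 0 < ‖V‖ := by rw [hab]; linarith [one_le (b - a)]
  have hV1 : 1 ≤ ‖V'‖ := by rw [hab']; exact one_le _
  have hV0' : 0 < ‖V'‖ := by linarith
  obtain ⟨e, he⟩ : ∃ e, e = ‖V‖⁻¹ • V := ⟨_, rfl⟩
  obtain ⟨e', he'⟩ : ∃ e', e' = ‖V'‖⁻¹ • V' := ⟨_, rfl⟩
  have hVe : V = ‖V‖ • e := by rw [he, smul_inv_smul₀ hV0.ne']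
  have hVe' : V' = ‖V'‖ • e' := by rw [he', smul_inv_smul₀ hV0'.ne']
  have hen : ‖e‖ = 1 := by rw [he, norm_smul, norm_inv, norm_norm, inv_mul_cancel₀ hV0.ne']
  have hen' : ‖e'‖ = 1 := by rw [he', norm_smul, norm_inv, norm_norm, inv_mul_cancel₀ hV0'.ne']
  have hee : ⟪e, e'⟫ = 0 := by rw [he, he', inner_smul_left, inner_smul_right, hperp]; simp
  have hQ : G (b, 1) = G (a, 0) + ‖V‖ • e := by rw [← hVe, hV]; abel
  have hQ' : G (b', 1) = G (a', 0) + ‖V'‖ • e' := by rw [← hVe', hV']; abel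
  have hP' : G (a', 0) = G (a, 0) + (s * ‖V‖) • e - (r * ‖V'‖) • e' := by
    rw [mul_smul, mul_smul, ← hVe, ← hVe', ← hmeet]; abel
  rcases le_or_gt r 0 with hr0 | hr0
  · obtain ⟨A, B, C, h1, h2, h3, h4⟩ := exists_triangle_of_closed_curve (u := a - b)
      (c := ‖V‖) (τ := (1 - s) * ‖V‖) (h := (1 - r) * ‖V'‖) (s₀ := b - lam) (s₁ := b' - lam)
      (s₂ := a) (s₃ := b + lam) hε0 hε hlam hV0 (by rw [hc2]; ring)
      (by nlinarith) H.norm_boundary_sub_le (by linarith) (by linarith)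
      (by linarith [hlt, neg_abs_le (b - a)])
      (by rw [H.glue_one, sub_lam]) (by ring) (by ring) (e := -e) (e' := e') (by rwa [norm_neg])
      hen' (by rw [inner_neg_left, hee, neg_zero])
      (by rw [sub_lam, hQ]; module)
      (by rw [sub_lam, sub_lam, hQ, hQ', hP']; module)
    refine ⟨A, B, C, h1, h2, h3, b - lam, fun t ht => h4 t ⟨ht.1, by linarith [ht.2]⟩⟩
  · have hr1 : 1 ≤ r := by
      by_contra hlt
      exact hr ⟨hr0, not_le.1 hlt⟩
    obtain ⟨A, B, C, h1, h2, h3, h4⟩ := exists_triangle_of_closed_curve (u := b - a)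
      (c := ‖V‖) (τ := s * ‖V‖) (h := r * ‖V'‖) (s₀ := a) (s₁ := a')
      (s₂ := b + lam) (s₃ := a + 2 * lam) hε0 hε hlam hV0 (by rw [hc2]; ring)
      (by nlinarith) H.norm_boundary_sub_le (by linarith) (by linarith)
      (by linarith [hlt, le_abs_self (b - a)])
      (H.add_two_mul a (by simp)) (by ring) (by ring) (e := e) (e' := -e') hen
      (by rwa [norm_neg]) (by rw [inner_neg_right, hee, neg_zero])
      (by rw [H.glue_one, hQ])
      (by rw [hP']; module)
    exact ⟨A, B, C, h1, h2, h3, a, fun t ht => h4 t ⟨ht.1, ht.2⟩⟩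

theorem exists_triangle_infDist_le {ε : ℝ} (hε0 : 0 < ε) (hε : ε < 1 / 4) (hlam : lam < √3 + ε) :
    ∃ A B C : E3, dist A B = 2 * √3 / 3 ∧ dist B C = 2 * √3 / 3 ∧ dist C A = 2 * √3 / 3 ∧
      ∀ p : ℝ × ℝ, p.2 ∈ Icc (0 : ℝ) 1 →
        Metric.infDist (G p) (convexHull ℝ {A, B, C}) ≤ 6 * √ε := by
  obtain ⟨A, B, C, h1, h2, h3, s₀, h4⟩ := H.exists_triangle hε0 hε hlam
  refine ⟨A, B, C, h1, h2, h3, ?_⟩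
  have hper : Function.Periodic (fun s => G (s, 0)) (2 * lam) :=
    fun s => H.add_two_mul s (by simp)
  have hbd : ∀ s, Metric.infDist (G (s, 0)) (convexHull ℝ {A, B, C}) ≤ 6 * √ε := by
    intro s
    obtain ⟨t, ht, hst⟩ := hper.exists_mem_Ico (by linarith [H.pos]) s s₀
    have := h4 t ⟨ht.1, ht.2.le⟩
    rwa [← show G (s, 0) = G (t, 0) from hst] at this
  rintro ⟨x, y⟩ hy
  obtain ⟨a, b, hab, hx⟩ := H.exists_isBend_through x hy
  have hG := H.bend_apply hab hy
  rw [hx] at hG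
  rw [hG, ← H.glue_one b]
  have hfin : ({A, B, C} : Set E3).Finite := by simp
  exact (convex_infDist_le (convex_convexHull ℝ _) (hfin.isCompact_convexHull ℝ)
    ⟨A, subset_convexHull ℝ _ (by simp)⟩ _).add_smul_sub_mem (hbd a) (hbd (b + lam)) hy

end IsPaperBand

end PaperBands

/-- If `0 < ε < 1/4` and `f` encodes a smooth embedded paper Moebius band of aspect
ratio `lam < √3 + ε`, with image `Ω = f '' (ℝ × [0,1])`, then there is an equilateral
triangle `convexHull ℝ {A, B, C}` of perimeter `2√3` such that every point of `Ω` is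
within distance `6√ε` of it. -/
theorem omega_close_to_equilateral_triangle
    (ε lam : ℝ) (hε0 : 0 < ε) (hε : ε < 1 / 4)
    (hlam : 0 < lam)
    (f : ℝ → ℝ → EuclideanSpace ℝ (Fin 3))
    (hsmooth : ContDiff ℝ (⊤ : ℕ∞) (fun p : ℝ × ℝ => f p.1 p.2))
    (hglue : ∀ x : ℝ, ∀ y ∈ Set.Icc (0 : ℝ) 1, f (x + lam) (1 - y) = f x y)
    (hisom : ∀ p : ℝ × ℝ, p.2 ∈ Set.Icc (0 : ℝ) 1 → ∀ v : ℝ × ℝ,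
      ‖fderiv ℝ (fun q : ℝ × ℝ => f q.1 q.2) p v‖ = Real.sqrt (v.1 ^ 2 + v.2 ^ 2))
    (hinj : ∀ x x' y y' : ℝ, x ∈ Set.Ico (0 : ℝ) lam → x' ∈ Set.Ico (0 : ℝ) lam →
      y ∈ Set.Icc (0 : ℝ) 1 → y' ∈ Set.Icc (0 : ℝ) 1 →
      f x y = f x' y' → x = x' ∧ y = y')
    (hratio : lam < Real.sqrt 3 + ε) :
    ∃ A B C : EuclideanSpace ℝ (Fin 3),
      dist A B = 2 * Real.sqrt 3 / 3 ∧ dist B C = 2 * Real.sqrt 3 / 3 ∧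
      dist C A = 2 * Real.sqrt 3 / 3 ∧
      ∀ x ∈ (fun p : ℝ × ℝ => f p.1 p.2) '' (Set.univ ×ˢ Set.Icc (0 : ℝ) 1),
        Metric.infDist x (convexHull ℝ {A, B, C}) ≤ 6 * Real.sqrt ε := by
  have H : IsPaperBand lam (fun p => f p.1 p.2) := ⟨hlam, hsmooth, hglue, hisom, hinj⟩
  obtain ⟨A, B, C, hAB, hBC, hCA, h⟩ := H.exists_triangle_infDist_le hε0 hε hratio
  refine ⟨A, B, C, hAB, hBC, hCA, ?_⟩
  rintro _ ⟨p, hp, rfl⟩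
  exact h p hp.2
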